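/- arXiv:2108.00463 — 4 statements merged into one kernel-verified Lean document; each statement's English description precedes it below -/
import Mathlib

section
/- Let n ≥ 30 and let N be a natural number with n ≤ N ≤ n + 1. Then for every N-dimensional subspace F of C(ℝ,ℝ) there exists a non-resonant n-chord diagram (a_i, b_i), i = 1,…,n, such that the subspace {f ∈ F : f(a_i) = f(b_i) for all i = 1,…,n} has dimension at least N − n + 4 (i.e., codimension at most n − 4 in F). -/
/-- The linear functional `f ↦ f b - f a` on the space `C(ℝ, ℝ)` of continuous
functions `ℝ → ℝ`. -/
noncomputable def evalDiff (a b : ℝ) : C(ℝ, ℝ) →ₗ[ℝ] ℝ where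
  toFun f := f b - f a
  map_add' f g := by simp; ring
  map_smul' c f := by simp [mul_sub]

section Cubical

open Function

variable {ι : Type*} [Fintype ι] [DecidableEq ι]

/-- Sum of the values of `b` at the neighbours of `w` in the directions `i` with `p (w i)`, mod 2.
Points of `ι → ℤ` encode the cells of the cubical grid (an odd coordinate is an open interval, an
even one is a vertex): `p = Odd` gives the coboundary of cochains, `p = Even` the boundary
of chains. -/
def neighborSum (p : ℤ → Prop) [DecidablePred p] (b : (ι → ℤ) → ZMod 2) (w : ι → ℤ) : ZMod 2 :=
  ∑ i, if p (w i) then b (w + Pi.single i 1) + b (w - Pi.single i 1) else 0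

theorem zmod_two_add_self (x : ZMod 2) : x + x = 0 := CharTwo.add_self_eq_zero x

theorem neighborSum_add (p : ℤ → Prop) [DecidablePred p] (b c : (ι → ℤ) → ZMod 2) :
    neighborSum p (b + c) = neighborSum p b + neighborSum p c := by
  funext w
  simp only [neighborSum, Pi.add_apply, ← Finset.sum_add_distrib]
  refine Finset.sum_congr rfl fun i _ => ?_
  split_ifs <;> ring

theorem neighborSum_one (p : ℤ → Prop) [DecidablePred p] :
    neighborSum p (1 : (ι → ℤ) → ZMod 2) = 0 := by
  funext w
  simp [neighborSum, zmod_two_add_self]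

theorem neighborSum_comp_neg (p : ℤ → Prop) [DecidablePred p] (hp : ∀ m, p (-m) ↔ p m)
    (b : (ι → ℤ) → ZMod 2) (w : ι → ℤ) :
    neighborSum p (fun z => b (-z)) w = neighborSum p b (-w) := by
  simp only [neighborSum, Pi.neg_apply, hp]
  refine Finset.sum_congr rfl fun i _ => ?_
  rw [neg_add', neg_sub', sub_neg_eq_add, add_comm (b _)]

theorem neighborSum_neighborSum (p : ℤ → Prop) [DecidablePred p]
    (hp : ∀ m, p m → ¬ p (m + 1) ∧ ¬ p (m - 1)) (b : (ι → ℤ) → ZMod 2) :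
    neighborSum p (neighborSum p b) = 0 := by
  funext w
  let t : ι × ι → ZMod 2 := fun x =>
    if x.1 ≠ x.2 ∧ p (w x.1) ∧ p (w x.2) then
      b (w + Pi.single x.1 1 + Pi.single x.2 1) + b (w + Pi.single x.1 1 - Pi.single x.2 1)
      + (b (w - Pi.single x.1 1 + Pi.single x.2 1) + b (w - Pi.single x.1 1 - Pi.single x.2 1))
    else 0
  have h1 : neighborSum p (neighborSum p b) w = ∑ x, t x := by
    rw [Fintype.sum_prod_type]
    simp only [neighborSum]
    refine Finset.sum_congr rfl fun i _ => ?_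
    by_cases hi : p (w i)
    · rw [if_pos hi, ← Finset.sum_add_distrib]
      refine Finset.sum_congr rfl fun k _ => ?_
      by_cases hik : i = k
      · subst hik
        simp [t, hp _ hi]
      · have hki : k ≠ i := fun h => hik h.symm
        by_cases hk : p (w k) <;> simp [t, hik, hi, hk, hki]
    · simp [t, hi]
  rw [h1]
  refine Finset.sum_involution (fun x _ => x.swap) ?_ ?_ ?_ ?_
  · rintro ⟨i, k⟩ -
    have : t (i, k) = t (k, i) := by
      simp only [t]
      by_cases h : i ≠ k ∧ p (w i) ∧ p (w k)
      · rw [if_pos h, if_pos ⟨h.1.symm, h.2.2, h.2.1⟩, add_add_add_comm]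
        congr 2 <;> congr 1 <;> abel
      · rw [if_neg h, if_neg (fun h' => h ⟨h'.1.symm, h'.2.2, h'.2.1⟩)]
    rw [Prod.swap_prod_mk, this, zmod_two_add_self]
  · rintro ⟨i, k⟩ - h h'
    simp only [Prod.swap_prod_mk, Prod.mk.injEq] at h'
    simp [t, h'.1] at h
  · simp
  · simp

theorem odd_step (m : ℤ) (h : Odd m) : ¬ Odd (m + 1) ∧ ¬ Odd (m - 1) := by grind

theorem even_step (m : ℤ) (h : Even m) : ¬ Even (m + 1) ∧ ¬ Even (m - 1) := by grind

theorem finsum_mul_neighborSum (c b : (ι → ℤ) → ZMod 2) (hc : c.support.Finite) :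
    ∑ᶠ z, c z * neighborSum Odd b z = ∑ᶠ z, neighborSum Even c z * b z := by
  have hf : ∀ (q : ι → ℤ) (f : (ι → ℤ) → ZMod 2), (support fun z => c (z + q) * f z).Finite := by
    intro q f
    refine (hc.preimage (f := fun z => z + q) (fun _ _ _ _ h => by simpa using h)).subset ?_
    intro z hz
    simp only [mem_support, Set.mem_preimage] at hz ⊢
    exact left_ne_zero_of_mul hz
  have e1 : ∀ z, c z * neighborSum Odd b z = ∑ i, (c z * (if Odd (z i) then
      b (z + Pi.single i 1) else 0) + c z * (if Odd (z i) then b (z - Pi.single i 1) else 0)) := by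
    intro z
    simp only [neighborSum, Finset.mul_sum]
    refine Finset.sum_congr rfl fun i _ => ?_
    split_ifs <;> ring
  have e2 : ∀ z, neighborSum Even c z * b z = ∑ i, (c (z + Pi.single i 1) * (if Even (z i) then
      b z else 0) + c (z + -Pi.single i 1) * (if Even (z i) then b z else 0)) := by
    intro z
    simp only [neighborSum, Finset.sum_mul, ← sub_eq_add_neg]
    refine Finset.sum_congr rfl fun i _ => ?_
    split_ifs <;> ring
  have hf0 : ∀ f : (ι → ℤ) → ZMod 2, (support fun z => c z * f z).Finite := by
    intro f
    simpa using hf 0 f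
  simp only [e1, e2]
  rw [finsum_sum_comm _ _ (fun i _ => ?_), finsum_sum_comm _ _ (fun i _ => ?_)]
  · refine Finset.sum_congr rfl fun i _ => ?_
    rw [finsum_add_distrib (hf0 _) (hf0 _), finsum_add_distrib (hf _ _) (hf _ _), add_comm]
    congr 1
    · rw [← finsum_comp_equiv (Equiv.addRight (Pi.single i 1 : ι → ℤ))]
      refine finsum_congr fun z => ?_
      have h : Odd (z i + 1) ↔ Even (z i) := by grind
      simp [h]
    · rw [← finsum_comp_equiv (Equiv.addRight (-Pi.single i 1 : ι → ℤ))]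
      refine finsum_congr fun z => ?_
      have h : Odd (z i + -1) ↔ Even (z i) := by grind
      simp [h]
  · exact ((hf _ _).union (hf _ _)).subset (support_add _ _)
  · exact ((hf0 _).union (hf0 _)).subset (support_add _ _)

end Cubical

section Hemisphere

open Function

/-- Indicator mod 2 of a decidable proposition. -/
def ind (q : Prop) [Decidable q] : ZMod 2 := if q then 1 else 0

theorem neighborSum_prod {κ : Type*} [Fintype κ] [DecidableEq κ] (p : ℤ → Prop) [DecidablePred p]
    (φ : κ → ℤ → ZMod 2) (z : κ → ℤ) :
    neighborSum p (fun z => ∏ i, φ i (z i)) z =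
      ∑ i, (if p (z i) then φ i (z i + 1) + φ i (z i - 1) else 0) *
        ∏ l ∈ Finset.univ.erase i, φ l (z l) := by
  refine Finset.sum_congr rfl fun i _ => ?_
  split_ifs
  · dsimp only
    rw [← Finset.mul_prod_erase _ _ (Finset.mem_univ i),
      ← Finset.mul_prod_erase _ _ (Finset.mem_univ i), add_mul]
    congr 2
    · simp
    · refine Finset.prod_congr rfl fun l hl => ?_
      simp [Finset.ne_of_mem_erase hl]
    · simp
    · refine Finset.prod_congr rfl fun l hl => ?_
      simp [Finset.ne_of_mem_erase hl]
  · simp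

theorem neighborSum_prod_blocks {β κ : Type*} [Fintype β] [DecidableEq β] [Fintype κ]
    [DecidableEq κ] (p : ℤ → Prop) [DecidablePred p] (φ : β → (κ → ℤ) → ZMod 2)
    (z : β × κ → ℤ) :
    neighborSum p (fun z => ∏ B, φ B (fun i => z (B, i))) z =
      ∑ B, neighborSum p (φ B) (fun i => z (B, i)) *
        ∏ B' ∈ Finset.univ.erase B, φ B' (fun i => z (B', i)) := by
  rw [neighborSum, Fintype.sum_prod_type]
  refine Finset.sum_congr rfl fun B _ => ?_
  rw [neighborSum, Finset.sum_mul]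
  refine Finset.sum_congr rfl fun i _ => ?_
  split_ifs
  · have h1 : ∀ m : ℤ, (fun k => (z + Pi.single (B, i) m : β × κ → ℤ) (B, k)) =
        (fun k => z (B, k)) + Pi.single i m := by
      intro m
      funext k
      by_cases hk : k = i <;> simp [hk]
    have h2 : ∀ m : ℤ, ∀ B' ∈ Finset.univ.erase B,
        φ B' (fun k => (z + Pi.single (B, i) m : β × κ → ℤ) (B', k)) =
          φ B' (fun k => z (B', k)) := by
      intro m B' hB'
      congr 1
      funext k
      simp [Finset.ne_of_mem_erase hB']
    have h3 : ∀ m : ℤ, ∏ B', φ B' (fun k => (z + Pi.single (B, i) m : β × κ → ℤ) (B', k)) =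
        φ B ((fun k => z (B, k)) + Pi.single i m) *
          ∏ B' ∈ Finset.univ.erase B, φ B' (fun k => z (B', k)) := by
      intro m
      rw [← Finset.mul_prod_erase _ _ (Finset.mem_univ B), h1, Finset.prod_congr rfl (h2 m)]
    have h4 := h3 (-1)
    rw [Pi.single_neg, Pi.single_neg, ← sub_eq_add_neg, ← sub_eq_add_neg] at h4
    rw [h3, h4, add_mul]
  · simp

variable {d : ℕ}

/-- The edges of the grid interval `[-L, L]`. -/
def fullEdges (L m : ℤ) : ZMod 2 := ind (Odd m ∧ |m| < L)

/-- The edges of the grid interval `[0, L]`. -/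
def halfEdges (L m : ℤ) : ZMod 2 := ind (Odd m ∧ 0 < m ∧ m < L)

/-- The vertex `0`. -/
def origin (m : ℤ) : ZMod 2 := ind (m = 0)

/-- Factors of a product chain: `[-L, L]` in the coordinates below `k`, `J` in the coordinate `k`
and the origin in the coordinates above `k`. -/
def profile (L : ℤ) (J : ℤ → ZMod 2) (k : ℕ) (l : Fin (d + 1)) : ℤ → ZMod 2 :=
  if (l : ℕ) < k then fullEdges L else if (l : ℕ) = k then J else origin

/-- The chain which is the product of the factors `profile L J k`. -/
def slab (L : ℤ) (J : ℤ → ZMod 2) (k : ℕ) (z : Fin (d + 1) → ℤ) : ZMod 2 :=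
  ∏ l, profile L J k l (z l)

/-- The `k`-dimensional upper hemisphere of the boundary of the cube `[-L, L] ^ (d + 1)`. -/
def hemisphere (L : ℤ) (k : ℕ) : (Fin (d + 1) → ℤ) → ZMod 2 :=
  neighborSum Even (slab L (halfEdges L) k) + slab L origin k

theorem slab_succ (L : ℤ) (k : ℕ) :
    slab L origin (k + 1) = (slab L (fullEdges L) k : (Fin (d + 1) → ℤ) → ZMod 2) := by
  funext z
  refine Finset.prod_congr rfl fun l _ => ?_
  unfold profile
  split_ifs <;> first | rfl | omega

theorem fullEdges_neg (L m : ℤ) : fullEdges L (-m) = fullEdges L m := by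
  simp [fullEdges]

theorem origin_neg (m : ℤ) : origin (-m) = origin m := by
  simp [origin]

theorem halfEdges_add_neg (L m : ℤ) : halfEdges L m + halfEdges L (-m) = fullEdges L m := by
  simp only [halfEdges, fullEdges, ind]
  grind

theorem slab_eq (L : ℤ) (J : ℤ → ZMod 2) {k : ℕ} (hk : k < d + 1) (z : Fin (d + 1) → ℤ) :
    slab L J k z = J (z ⟨k, hk⟩) *
      ∏ l ∈ Finset.univ.erase ⟨k, hk⟩, profile L origin k l (z l) := by
  rw [slab, ← Finset.mul_prod_erase _ _ (Finset.mem_univ (⟨k, hk⟩ : Fin (d + 1)))]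
  congr 1
  · simp [profile]
  · refine Finset.prod_congr rfl fun l hl => ?_
    have : (l : ℕ) ≠ k := fun h => Finset.ne_of_mem_erase hl (Fin.ext h)
    simp [profile, this]

theorem profile_origin_neg (L : ℤ) (k : ℕ) (l : Fin (d + 1)) (m : ℤ) :
    profile L origin k l (-m) = profile L origin k l m := by
  unfold profile
  split_ifs <;> simp [fullEdges_neg, origin_neg]

theorem slab_origin_neg (L : ℤ) (k : ℕ) (z : Fin (d + 1) → ℤ) :
    slab L origin k (-z) = slab L origin k z :=
  Finset.prod_congr rfl fun l _ => profile_origin_neg L k l (z l)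

theorem slab_half_add_neg (L : ℤ) {k : ℕ} (hk : k < d + 1) (z : Fin (d + 1) → ℤ) :
    slab L (halfEdges L) k z + slab L (halfEdges L) k (-z) = slab L origin (k + 1) z := by
  rw [slab_succ, slab_eq _ _ hk, slab_eq _ _ hk, slab_eq _ _ hk]
  simp only [Pi.neg_apply, profile_origin_neg]
  rw [← add_mul, halfEdges_add_neg]

theorem boundary_hemisphere_succ (L : ℤ) {k : ℕ} (hk : k < d + 1) (z : Fin (d + 1) → ℤ) :
    neighborSum Even (hemisphere L (k + 1)) z = hemisphere L k z + hemisphere L k (-z) := by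
  have h : slab L origin (k + 1) = slab L (halfEdges L) k +
      fun z : Fin (d + 1) → ℤ => slab L (halfEdges L) k (-z) :=
    funext fun z => (slab_half_add_neg L hk z).symm
  rw [hemisphere, neighborSum_add, neighborSum_neighborSum _ even_step, zero_add, h,
    neighborSum_add, Pi.add_apply, neighborSum_comp_neg _ (fun m => even_neg), hemisphere,
    Pi.add_apply, Pi.add_apply, slab_origin_neg, add_add_add_comm, zmod_two_add_self, add_zero]

theorem origin_step {m : ℤ} (hm : Even m) : origin (m + 1) + origin (m - 1) = 0 := by
  simp only [origin, ind]
  grind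

theorem fullEdges_step {L m : ℤ} (hL : Even L) (hL0 : 0 < L) (hm : Even m) :
    fullEdges L (m + 1) + fullEdges L (m - 1) = ind (|m| = L) := by
  simp only [fullEdges, ind]
  grind

theorem halfEdges_step {L m : ℤ} (hL : Even L) (hL0 : 0 < L) (hm : Even m) :
    halfEdges L (m + 1) + halfEdges L (m - 1) = ind (m = L) + origin m := by
  simp only [halfEdges, origin, ind]
  grind

theorem boundary_hemisphere_zero (L : ℤ) (z : Fin (d + 1) → ℤ) :
    neighborSum Even (hemisphere L 0) z = 0 := by
  rw [hemisphere, neighborSum_add, neighborSum_neighborSum _ even_step, zero_add]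
  unfold slab
  rw [neighborSum_prod]
  refine Finset.sum_eq_zero fun i _ => ?_
  have : profile L origin 0 i = origin := by simp [profile]
  split_ifs with h
  · rw [this, origin_step h, zero_mul]
  · rw [zero_mul]

/-- The part of the boundary of `[-L, L]` or `[0, L]` on the boundary of the cube. -/
def rim (L : ℤ) (k : ℕ) (l : Fin (d + 1)) (m : ℤ) : ZMod 2 :=
  if (l : ℕ) < k then ind (|m| = L) else if (l : ℕ) = k then ind (m = L) else 0

theorem hemisphere_eq {L : ℤ} (hL : Even L) (hL0 : 0 < L) {k : ℕ} (hk : k < d + 1)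
    (z : Fin (d + 1) → ℤ) :
    hemisphere L k z = ∑ i, rim L k i (z i) *
      ∏ l ∈ Finset.univ.erase i, profile L (halfEdges L) k l (z l) := by
  have h0 : slab L origin k z = ∑ i : Fin (d + 1), (if (i : ℕ) = k then origin (z i) else 0) *
      ∏ l ∈ Finset.univ.erase i, profile L (halfEdges L) k l (z l) := by
    rw [slab_eq _ _ hk, Finset.sum_eq_single ⟨k, hk⟩]
    · rw [if_pos rfl]
      congr 1
      refine Finset.prod_congr rfl fun l hl => ?_
      have : (l : ℕ) ≠ k := fun h => Finset.ne_of_mem_erase hl (Fin.ext h)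
      simp [profile, this]
    · intro i _ hi
      rw [if_neg fun h => hi (Fin.ext h), zero_mul]
    · simp
  rw [hemisphere, Pi.add_apply, h0]
  unfold slab
  rw [neighborSum_prod, ← Finset.sum_add_distrib]
  refine Finset.sum_congr rfl fun i _ => ?_
  rw [← add_mul]
  congr 1
  unfold profile rim
  by_cases hz : Even (z i)
  · rw [if_pos hz]
    split_ifs with h1 h2 h3
    · omega
    · rw [fullEdges_step hL hL0 hz, add_zero]
    · rw [halfEdges_step hL hL0 hz, add_assoc, zmod_two_add_self, add_zero]
    · rw [origin_step hz, zero_add]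
  · have h1 : z i ≠ 0 := fun h => hz (by simp [h])
    have h2 : z i ≠ L := fun h => hz (h ▸ hL)
    have h3 : |z i| ≠ L := fun h => hz (even_abs.1 (h ▸ hL))
    simp [hz, origin, ind, h1, h2, h3]

theorem hemisphere_mem {L : ℤ} (hL : Even L) (hL0 : 0 < L) {k : ℕ} (hk : k < d + 1)
    {z : Fin (d + 1) → ℤ} (hz : hemisphere L k z ≠ 0) :
    (∃ i, |z i| = L) ∧ ∀ i, |z i| ≤ L := by
  rw [hemisphere_eq hL hL0 hk] at hz
  obtain ⟨i, -, hi⟩ := Finset.exists_ne_zero_of_sum_ne_zero hz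
  have h1 : |z i| = L := by
    have := left_ne_zero_of_mul hi
    unfold rim ind at this
    grind
  refine ⟨⟨i, h1⟩, fun l => ?_⟩
  by_cases hl : l = i
  · exact hl ▸ h1.le
  · have := Finset.prod_ne_zero_iff.1 (right_ne_zero_of_mul hi) l (by simp [hl])
    unfold profile fullEdges halfEdges origin ind at this
    grind

theorem hemisphere_zero_apply {L : ℤ} (hL : Even L) (hL0 : 0 < L) (z : Fin (d + 1) → ℤ) :
    hemisphere L 0 z = ind (z = Pi.single 0 L) := by
  rw [hemisphere_eq hL hL0 d.succ_pos, Finset.sum_eq_single 0]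
  · by_cases h : z = Pi.single 0 L
    · subst h
      have : ∀ l ∈ Finset.univ.erase (0 : Fin (d + 1)), profile L (halfEdges L) 0 l
          ((Pi.single 0 L : Fin (d + 1) → ℤ) l) = 1 := fun l hl => by
        simp [profile, origin, ind, Finset.ne_of_mem_erase hl]
      rw [Finset.prod_eq_one this]
      simp [rim, ind]
    · rw [ind, if_neg h]
      by_contra h0
      refine h (funext fun l => ?_)
      by_cases hl : l = 0
      · have := left_ne_zero_of_mul h0
        subst hl
        simpa [rim, ind] using this
      · have := Finset.prod_ne_zero_iff.1 (right_ne_zero_of_mul h0) l (by simp [hl])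
        simpa [profile, hl, origin, ind] using this
  · intro i _ hi
    simp [rim, hi]
  · simp

end Hemisphere

section Products

open Function

variable {β : Type*}

/-- The cells whose projection to each block lies on the boundary of the cube. -/
def OnBoundary {κ : Type*} (L : ℤ) (z : β × κ → ℤ) : Prop := ∀ B, ∃ i, |z (B, i)| = L

variable {d : ℕ} [Fintype β]

/-- The product over the blocks of hemispheres of dimensions `k B`. -/
def hemispheres (L : ℤ) (k : β → ℕ) (z : β × Fin (d + 1) → ℤ) : ZMod 2 :=
  ∏ B, hemisphere L (k B) (fun i => z (B, i))

theorem hemispheres_mem {L : ℤ} (hL : Even L) (hL0 : 0 < L) {k : β → ℕ} (hk : ∀ B, k B ≤ d)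
    {z : β × Fin (d + 1) → ℤ} (hz : hemispheres L k z ≠ 0) :
    OnBoundary L z ∧ ∀ x, |z x| ≤ L := by
  have h := fun B => hemisphere_mem hL hL0 (Nat.lt_succ_of_le (hk B))
    (Finset.prod_ne_zero_iff.1 hz B (Finset.mem_univ B))
  exact ⟨fun B => (h B).1, fun x => (h x.1).2 x.2⟩

theorem finite_support_hemispheres {L : ℤ} (hL : Even L) (hL0 : 0 < L) {k : β → ℕ}
    (hk : ∀ B, k B ≤ d) :
    (support (hemispheres L k : (β × Fin (d + 1) → ℤ) → ZMod 2)).Finite := by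
  classical
  refine (Set.finite_Icc (fun _ => -L) (fun _ => L)).subset fun z hz => ?_
  have := (hemispheres_mem hL hL0 hk hz).2
  exact ⟨fun x => (abs_le.1 (this x)).1, fun x => (abs_le.1 (this x)).2⟩

theorem finsum_hemispheres_zero {L : ℤ} (hL : Even L) (hL0 : 0 < L) :
    ∑ᶠ z : β × Fin (d + 1) → ℤ, hemispheres L (fun _ : β => 0) z = 1 := by
  rw [finsum_eq_single _ (fun x => if x.2 = 0 then L else 0)]
  · refine Finset.prod_eq_one fun B _ => ?_
    rw [hemisphere_zero_apply hL hL0, ind, if_pos]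
    funext i
    simp [Pi.single_apply]
  · intro z hz
    by_contra h
    refine hz (funext fun x => ?_)
    have := Finset.prod_ne_zero_iff.1 h x.1 (Finset.mem_univ _)
    rw [hemisphere_zero_apply hL hL0, ind] at this
    have h2 : (fun i => z (x.1, i)) = Pi.single 0 L := by
      by_contra h'
      exact this (if_neg h')
    simpa [Pi.single_apply] using congrFun h2 x.2

end Products

section Blocks

open Function

variable {β κ : Type*} [DecidableEq β]

/-- Change the sign of the coordinates in the block `B`. -/
def flipBlock {R : Type*} [Neg R] (B : β) (u : β × κ → R) : β × κ → R :=
  fun x => if x.1 = B then -u x else u x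

theorem flipBlock_flipBlock {R : Type*} [InvolutiveNeg R] (B : β) (u : β × κ → R) :
    flipBlock B (flipBlock B u) = u := by
  funext x
  simp only [flipBlock]
  split_ifs <;> simp

theorem neighborSum_comp_flipBlock [Fintype β] [Fintype κ] [DecidableEq κ] (p : ℤ → Prop)
    [DecidablePred p] (hp : ∀ m, p (-m) ↔ p m) (B : β) (b : (β × κ → ℤ) → ZMod 2)
    (w : β × κ → ℤ) :
    neighborSum p (fun z => b (flipBlock B z)) w = neighborSum p b (flipBlock B w) := by
  refine Finset.sum_congr rfl fun i _ => ?_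
  by_cases hi : i.1 = B
  · have e1 : flipBlock B (w + Pi.single i 1) = flipBlock B w - Pi.single i 1 := by
      funext x
      by_cases hx : x = i
      · subst hx
        simp [flipBlock, hi]
        ring
      · simp [flipBlock, hx]
    have e2 : flipBlock B (w - Pi.single i 1) = flipBlock B w + Pi.single i 1 := by
      funext x
      by_cases hx : x = i
      · subst hx
        simp [flipBlock, hi]
        ring
      · simp [flipBlock, hx]
    have e3 : p (flipBlock B w i) ↔ p (w i) := by simp [flipBlock, hi, hp]
    simp only [e1, e2, e3, add_comm]
  · have e1 : flipBlock B (w + Pi.single i 1) = flipBlock B w + Pi.single i 1 := by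
      funext x
      by_cases hx : x = i
      · subst hx
        simp [flipBlock, hi]
      · simp [flipBlock, hx]
    have e2 : flipBlock B (w - Pi.single i 1) = flipBlock B w - Pi.single i 1 := by
      funext x
      by_cases hx : x = i
      · subst hx
        simp [flipBlock, hi]
      · simp [flipBlock, hx]
    have e3 : p (flipBlock B w i) ↔ p (w i) := by simp [flipBlock, hi]
    simp only [e1, e2, e3]

theorem OnBoundary.flipBlock {L : ℤ} {z : β × κ → ℤ} (hz : OnBoundary L z) (B : β) :
    OnBoundary L (flipBlock B z) := by
  intro B'
  obtain ⟨i, hi⟩ := hz B'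
  refine ⟨i, ?_⟩
  simp only [_root_.flipBlock]
  split_ifs <;> simp [hi]

variable [DecidableEq κ]

theorem OnBoundary.face {L : ℤ} (hL : Even L) {z : β × κ → ℤ} (hz : OnBoundary L z)
    {i : β × κ} (hi : Odd (z i)) (m : ℤ) : OnBoundary L (z + Pi.single i m) := by
  intro B
  obtain ⟨k, hk⟩ := hz B
  refine ⟨k, ?_⟩
  have h : (B, k) ≠ i := by
    rintro rfl
    exact Int.not_even_iff_odd.2 hi (even_abs.1 (hk ▸ hL))
  simp [h, hk]

variable [Fintype β] [Fintype κ]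

theorem neighborSum_congr_onBoundary {L : ℤ} (hL : Even L) {b c : (β × κ → ℤ) → ZMod 2}
    (h : ∀ z, OnBoundary L z → b z = c z) {z : β × κ → ℤ} (hz : OnBoundary L z) :
    neighborSum Odd b z = neighborSum Odd c z := by
  refine Finset.sum_congr rfl fun i _ => ?_
  split_ifs with hi
  · have := h _ (hz.face hL hi (-1))
    rw [Pi.single_neg, ← sub_eq_add_neg] at this
    rw [h _ (hz.face hL hi 1), this]
  · rfl

/-- The cochain obtained from `1` by repeatedly multiplying by a function from the list and
taking the coboundary. -/
def iterCoboundary (l : List (β × ((β × κ → ℤ) → ZMod 2))) : (β × κ → ℤ) → ZMod 2 :=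
  l.foldr (fun p b => neighborSum Odd (p.2 * b)) 1

theorem neighborSum_iterCoboundary (l : List (β × ((β × κ → ℤ) → ZMod 2))) :
    neighborSum Odd (iterCoboundary l) = 0 := by
  cases l with
  | nil => exact neighborSum_one _
  | cons p l => exact neighborSum_neighborSum _ odd_step _

/-- On the boundary, `s` is odd in the block `B` and even in the other blocks. -/
def IsSignOf (L : ℤ) (B : β) (s : (β × κ → ℤ) → ZMod 2) : Prop :=
  ∀ z, OnBoundary L z → ∀ B', s (flipBlock B' z) = s z + if B' = B then 1 else 0

theorem iterCoboundary_flipBlock {L : ℤ} (hL : Even L)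
    (l : List (β × ((β × κ → ℤ) → ZMod 2))) (hl : ∀ p ∈ l, IsSignOf L p.1 p.2)
    (B : β) : ∀ z, OnBoundary L z →
      iterCoboundary l (flipBlock B z) = iterCoboundary l z := by
  induction l with
  | nil => intro z _; rfl
  | cons p l ih =>
    intro z hz
    have hp := hl p (by simp)
    have ih := ih fun q hq => hl q (by simp [hq])
    change neighborSum Odd (p.2 * iterCoboundary l) (flipBlock B z) =
      neighborSum Odd (p.2 * iterCoboundary l) z
    rw [← neighborSum_comp_flipBlock _ (fun m => odd_neg)]
    by_cases hB : B = p.1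
    · rw [neighborSum_congr_onBoundary hL (c := p.2 * iterCoboundary l + iterCoboundary l) _ hz,
        neighborSum_add, neighborSum_iterCoboundary, add_zero]
      intro y hy
      rw [Pi.mul_apply, hp y hy B, ih y hy, if_pos hB, add_mul, one_mul]
      rfl
    · refine neighborSum_congr_onBoundary hL (fun y hy => ?_) hz
      simp [hp y hy B, ih y hy, hB]

variable {d : ℕ}

theorem boundary_hemispheres (L : ℤ) {k : β → ℕ} (hk : ∀ B, k B ≤ d)
    (z : β × Fin (d + 1) → ℤ) :
    neighborSum Even (hemispheres L k) z = ∑ B, if k B = 0 then 0 else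
      (hemispheres L (update k B (k B - 1)) z +
        hemispheres L (update k B (k B - 1)) (flipBlock B z)) := by
  unfold hemispheres
  rw [neighborSum_prod_blocks]
  refine Finset.sum_congr rfl fun B _ => ?_
  split_ifs with h
  · rw [h, boundary_hemisphere_zero, zero_mul]
  · obtain ⟨m, hm⟩ := Nat.exists_eq_succ_of_ne_zero h
    have h1 : ∀ y : β × Fin (d + 1) → ℤ, (∀ B' ≠ B, ∀ i, y (B', i) = z (B', i)) →
        ∏ B', hemisphere L (update k B (k B - 1) B') (fun i => y (B', i)) =
        hemisphere L m (fun i => y (B, i)) *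
          ∏ B' ∈ Finset.univ.erase B, hemisphere L (k B') (fun i => z (B', i)) := by
      intro y hy
      rw [← Finset.mul_prod_erase _ _ (Finset.mem_univ B)]
      congr 1
      · simp [hm]
      · refine Finset.prod_congr rfl fun B' hB' => ?_
        have := Finset.ne_of_mem_erase hB'
        simp [this, hy B' this]
    rw [h1 z (by simp), h1 (flipBlock B z) (fun B' hB' i => by simp [flipBlock, hB']), ← add_mul,
      hm, boundary_hemisphere_succ L (by have := hk B; omega)]
    congr 3
    simp [flipBlock]
    rfl

theorem finsum_hemispheres_iterCoboundary {L : ℤ} (hL : Even L) (hL0 : 0 < L)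
    (l : List (β × ((β × Fin (d + 1) → ℤ) → ZMod 2))) (hl : ∀ p ∈ l, IsSignOf L p.1 p.2)
    (k : β → ℕ) (hk : ∀ B, k B = (l.map Prod.fst).count B) (hd : ∀ B, k B ≤ d) :
    ∑ᶠ z, hemispheres L k z * iterCoboundary l z = 1 := by
  induction l generalizing k with
  | nil =>
    have : k = fun _ => 0 := funext fun B => by simp [hk]
    simpa [this, iterCoboundary] using finsum_hemispheres_zero hL hL0
  | cons p l ih =>
    have hp := hl p (by simp)
    have hl' : ∀ q ∈ l, IsSignOf L q.1 q.2 := fun q hq => hl q (by simp [hq])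
    have hinv := iterCoboundary_flipBlock hL l hl'
    set a := iterCoboundary l
    have ha : iterCoboundary (p :: l) = neighborSum Odd (p.2 * a) := rfl
    have hdu : ∀ B B', update k B (k B - 1) B' ≤ d := by
      intro B B'
      by_cases h : B' = B
      · subst h
        simpa using (Nat.sub_le _ _).trans (hd B')
      · simpa [h] using hd B'
    have hfin := fun B => finite_support_hemispheres hL hL0 (hdu B)
    have hfinm : ∀ B (f : (β × Fin (d + 1) → ℤ) → ZMod 2),
        (support fun z => hemispheres L (update k B (k B - 1)) z * f z).Finite := fun B f =>
      (hfin B).subset fun z hz => left_ne_zero_of_mul hz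
    let e : β → Equiv.Perm (β × Fin (d + 1) → ℤ) := fun B =>
      (show Involutive (flipBlock B) from flipBlock_flipBlock B).toPerm
    have hfinm' : ∀ B (f : (β × Fin (d + 1) → ℤ) → ZMod 2),
        (support fun z => hemispheres L (update k B (k B - 1)) (flipBlock B z) * f z).Finite :=
      fun B f => ((hfin B).preimage (e B).injective.injOn).subset
        fun z hz => left_ne_zero_of_mul hz
    have hterm : ∀ B, k B ≠ 0 → ∑ᶠ z, (hemispheres L (update k B (k B - 1)) z +
        hemispheres L (update k B (k B - 1)) (flipBlock B z)) * (p.2 * a) z =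
        if B = p.1 then 1 else 0 := by
      intro B hB
      simp only [add_mul]
      rw [finsum_add_distrib (hfinm B _) (hfinm' B _)]
      have h1 : ∑ᶠ z, hemispheres L (update k B (k B - 1)) (flipBlock B z) * (p.2 * a) z =
          ∑ᶠ z, hemispheres L (update k B (k B - 1)) z * (p.2 * a) (flipBlock B z) := by
        rw [← finsum_comp_equiv (e B)]
        refine finsum_congr fun z => ?_
        change hemispheres L (update k B (k B - 1)) (flipBlock B (flipBlock B z)) * _ = _
        rw [flipBlock_flipBlock]
        rfl
      rw [h1, ← finsum_add_distrib (hfinm B _) (hfinm B _)]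
      have h2 : ∀ z, hemispheres L (update k B (k B - 1)) z * (p.2 * a) z +
          hemispheres L (update k B (k B - 1)) z * (p.2 * a) (flipBlock B z) =
          if B = p.1 then hemispheres L (update k B (k B - 1)) z * a z else 0 := by
        intro z
        by_cases hz : hemispheres L (update k B (k B - 1)) z = 0
        · simp [hz]
        · have hz' := (hemispheres_mem hL hL0 (hdu B) hz).1
          rw [Pi.mul_apply, Pi.mul_apply, hp z hz' B, hinv B z hz', ← mul_add, ← add_mul,
            ← add_assoc, zmod_two_add_self, zero_add]
          split_ifs <;> simp
      simp only [h2]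
      split_ifs with h
      · refine ih hl' _ (fun B' => ?_) (hdu B)
        by_cases h' : B' = B
        · subst h'
          simp [hk, h]
        · have : p.1 ≠ B' := fun e => h' (e.symm.trans h.symm)
          simp [h', hk, this]
      · simp
    have hsup : ∀ B, (support fun z => (hemispheres L (update k B (k B - 1)) z +
        hemispheres L (update k B (k B - 1)) (flipBlock B z)) * (p.2 * a) z).Finite := by
      intro B
      simp only [add_mul]
      exact ((hfinm B _).union (hfinm' B _)).subset (support_add _ _)
    rw [ha, finsum_mul_neighborSum _ _ (finite_support_hemispheres hL hL0 hd)]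
    simp only [boundary_hemispheres L hd, Finset.sum_mul, ite_mul, zero_mul]
    rw [finsum_sum_comm]
    · rw [Finset.sum_eq_single p.1]
      · have h0 : k p.1 ≠ 0 := by simp [hk]
        exact (finsum_congr fun z => if_neg h0).trans ((hterm p.1 h0).trans (if_pos rfl))
      · intro B _ hB
        by_cases h0 : k B = 0
        · simp [h0]
        · exact (finsum_congr fun z => if_neg h0).trans ((hterm B h0).trans (if_neg hB))
      · simp
    · intro B _
      by_cases h0 : k B = 0
      · simp [h0, HasFiniteSupport]
      · simp only [if_neg h0]
        exact hsup B

/-- `y` is a vertex or a face of some dimension of the cell `z`, or `z` itself. -/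
def IsFace (y z : β × κ → ℤ) : Prop := ∀ i, y i = z i ∨ Odd (z i) ∧ |y i - z i| = 1

theorem iterCoboundary_ne_zero {l : List (β × ((β × κ → ℤ) → ZMod 2))} {z : β × κ → ℤ}
    (hz : iterCoboundary l z ≠ 0) :
    ∀ p ∈ l, ∃ y y', IsFace y z ∧ IsFace y' z ∧ p.2 y ≠ p.2 y' := by
  induction l generalizing z with
  | nil => simp
  | cons q l ih =>
    have hface : ∀ i, Odd (z i) → IsFace (z + Pi.single i 1) z ∧ IsFace (z - Pi.single i 1) z := by
      intro i hi
      constructor <;>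
      · intro k
        by_cases hk : k = i
        · subst hk
          simp [hi]
        · simp [hk]
    intro p hp
    rcases List.mem_cons.1 hp with rfl | hp
    · by_contra! hcon
      refine hz ?_
      change neighborSum Odd (p.2 * iterCoboundary l) z = 0
      have h0 := congrFun (neighborSum_iterCoboundary l) z
      have hself : IsFace z z := fun i => Or.inl rfl
      have : neighborSum Odd (p.2 * iterCoboundary l) z =
          p.2 z * neighborSum Odd (iterCoboundary l) z := by
        rw [neighborSum, neighborSum, Finset.mul_sum]
        refine Finset.sum_congr rfl fun i _ => ?_
        split_ifs with hi
        · rw [Pi.mul_apply, Pi.mul_apply, hcon _ _ (hface i hi).1 hself,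
            hcon _ _ (hface i hi).2 hself, mul_add]
        · simp
      rw [this, h0, Pi.zero_apply, mul_zero]
    · obtain ⟨i, -, hi⟩ := Finset.exists_ne_zero_of_sum_ne_zero
        (show neighborSum Odd (q.2 * iterCoboundary l) z ≠ 0 from hz)
      have hodd : Odd (z i) := by
        by_contra h
        exact hi (if_neg h)
      rw [if_pos hodd] at hi
      have htrans : ∀ y w, IsFace y w → IsFace w z → IsFace y z := by
        intro y w h1 h2 k
        have := h1 k
        have := h2 k
        grind
      by_cases h1 : iterCoboundary l (z + Pi.single i 1) = 0
      · have h2 : iterCoboundary l (z - Pi.single i 1) ≠ 0 := by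
          intro h2
          exact hi (by simp [h1, h2])
        obtain ⟨y, y', hy, hy', h⟩ := ih h2 p hp
        exact ⟨y, y', htrans _ _ hy (hface i hodd).2, htrans _ _ hy' (hface i hodd).2, h⟩
      · obtain ⟨y, y', hy, hy', h⟩ := ih h1 p hp
        exact ⟨y, y', htrans _ _ hy (hface i hodd).1, htrans _ _ hy' (hface i hodd).1, h⟩

/-- Combinatorial form of the Borsuk-Ulam theorem for products of spheres. -/
theorem exists_cell_of_signs {L : ℤ} (hL : Even L) (hL0 : 0 < L)
    (s : β → Fin d → (β × Fin (d + 1) → ℤ) → ZMod 2) (hs : ∀ B K, IsSignOf L B (s B K)) :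
    ∃ z : β × Fin (d + 1) → ℤ, OnBoundary L z ∧ (∀ x, |z x| ≤ L) ∧
      ∀ B K, ∃ y y', IsFace y z ∧ IsFace y' z ∧ s B K y ≠ s B K y' := by
  let l : List (β × ((β × Fin (d + 1) → ℤ) → ZMod 2)) :=
    (Finset.univ : Finset (β × Fin d)).toList.map fun x => (x.1, s x.1 x.2)
  have hcount : ∀ B, (l.map Prod.fst).count B = d := by
    intro B
    have h1 : l.map Prod.fst = (Finset.univ : Finset (β × Fin d)).toList.map Prod.fst := by
      simp [l, Function.comp_def]
    have h2 : ((Finset.univ : Finset (β × Fin d)).toList.map Prod.fst).count B =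
        ((Finset.univ : Finset (β × Fin d)).val.map Prod.fst).count B := by
      rw [← Multiset.coe_count, ← Multiset.map_coe, Finset.coe_toList]
    rw [h1, h2, Multiset.count_map, ← Finset.filter_val, Finset.card_val,
      show (Finset.univ.filter fun x : β × Fin d => B = x.1) = {B} ×ˢ Finset.univ by
        ext ⟨x, y⟩; simp [eq_comm]]
    simp
  have hsum := finsum_hemispheres_iterCoboundary hL hL0 l
    (fun p hp => by
      obtain ⟨x, -, rfl⟩ := List.mem_map.1 hp
      exact hs x.1 x.2) (fun _ => d) (fun B => (hcount B).symm) (fun _ => le_rfl)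
  obtain ⟨z, hz⟩ : ∃ z, hemispheres L (fun _ : β => d) z * iterCoboundary l z ≠ 0 := by
    by_contra! h
    simp [h] at hsum
  obtain ⟨h1, h2⟩ := hemispheres_mem hL hL0 (fun _ => le_rfl) (left_ne_zero_of_mul hz)
  refine ⟨z, h1, h2, fun B K => ?_⟩
  exact iterCoboundary_ne_zero (right_ne_zero_of_mul hz) (B, s B K)
    (List.mem_map.2 ⟨(B, K), by simp, rfl⟩)

end Blocks

section BorsukUlam

open Function

/-- The first nonzero coordinate is positive. -/
def FirstPos {m : ℕ} (v : Fin m → ℤ) : Prop := ∃ i, 0 < v i ∧ ∀ l < i, v l = 0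

theorem firstPos_neg {m : ℕ} {v : Fin m → ℤ} (hv : v ≠ 0) : FirstPos (-v) ↔ ¬ FirstPos v := by
  obtain ⟨i, hi, hmin⟩ : ∃ i, v i ≠ 0 ∧ ∀ l < i, v l = 0 := by
    obtain ⟨k, hk⟩ := Function.ne_iff.1 hv
    obtain ⟨i, hi, hmin⟩ := WellFounded.has_min (wellFounded_lt (α := Fin m)) {i | v i ≠ 0} ⟨k, hk⟩
    exact ⟨i, hi, fun l hl => by_contra fun h => hmin l h hl⟩
  have key : ∀ w : Fin m → ℤ, w i ≠ 0 → (∀ l < i, w l = 0) → (FirstPos w ↔ 0 < w i) := by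
    intro w hw hw0
    refine ⟨?_, fun h => ⟨i, h, hw0⟩⟩
    rintro ⟨k, hk, hk0⟩
    rcases lt_trichotomy k i with h | h | h
    · exact absurd (hw0 k h) hk.ne'
    · exact h ▸ hk
    · exact absurd (hk0 i h) hw
  rw [key v hi hmin, key (-v) (by simpa using hi) (fun l hl => by simp [hmin l hl])]
  simp only [Pi.neg_apply]
  omega

variable {β : Type*} [Fintype β] [DecidableEq β] {d : ℕ}

theorem exists_cell_of_odd {L : ℤ} (hL : Even L) (hL0 : 0 < L)
    (f : β → Fin d → (β × Fin (d + 1) → ℤ) → ℝ)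
    (hodd : ∀ B K z, f B K (flipBlock B z) = -f B K z)
    (heven : ∀ B B', B' ≠ B → ∀ K z, f B K (flipBlock B' z) = f B K z) :
    ∃ z : β × Fin (d + 1) → ℤ, OnBoundary L z ∧ (∀ x, |z x| ≤ L) ∧
      ∀ B K, ∃ y y', IsFace y z ∧ IsFace y' z ∧ f B K y * f B K y' ≤ 0 := by
  classical
  let s : β → Fin d → (β × Fin (d + 1) → ℤ) → ZMod 2 := fun B K z =>
    ind (0 < f B K z ∨ f B K z = 0 ∧ FirstPos fun i => z (B, i))
  obtain ⟨z, h1, h2, h3⟩ := exists_cell_of_signs hL hL0 s (by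
    intro B K z hz B'
    by_cases hB : B' = B
    · subst hB
      have h0 : (fun i => z (B', i)) ≠ 0 := by
        obtain ⟨i, hi⟩ := hz B'
        intro h
        have := congrFun h i
        simp only [Pi.zero_apply] at this
        simp [this] at hi
        omega
      have h1 : (fun i => flipBlock B' z (B', i)) = -(fun i => z (B', i)) := by
        funext i
        simp [flipBlock]
      simp only [s, h1, firstPos_neg h0, hodd, ind]
      rcases lt_trichotomy (f B' K z) 0 with h | h | h
      · simp [h, h.ne, h.not_gt]
      · by_cases hp : FirstPos fun i => z (B', i) <;> simp [h, hp, zmod_two_add_self]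
      · simp [h, h.ne', h.not_gt, zmod_two_add_self]
    · have h1 : (fun i => flipBlock B' z (B, i)) = (fun i => z (B, i)) := by
        funext i
        simp [flipBlock, Ne.symm hB]
      simp [s, h1, heven B B' hB K, hB])
  refine ⟨z, h1, h2, fun B K => ?_⟩
  obtain ⟨y, y', hy, hy', h⟩ := h3 B K
  refine ⟨y, y', hy, hy', ?_⟩
  by_contra! hpos
  refine h ?_
  simp only [s, ind]
  rcases mul_pos_iff.1 hpos with ⟨a, b⟩ | ⟨a, b⟩
  · simp [a, b]
  · simp [a.ne, b.ne, a.not_gt, b.not_gt]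

/-- The Borsuk-Ulam theorem for products of spheres. -/
theorem exists_common_zero (f : β → Fin d → (β × Fin (d + 1) → ℝ) → ℝ)
    (hf : ∀ B K, Continuous (f B K))
    (hodd : ∀ B K u, f B K (flipBlock B u) = -f B K u)
    (heven : ∀ B B', B' ≠ B → ∀ K u, f B K (flipBlock B' u) = f B K u) :
    ∃ u : β × Fin (d + 1) → ℝ, (∀ x, |u x| ≤ 1) ∧ (∀ B, ∃ i, |u (B, i)| = 1) ∧
      ∀ B K, f B K u = 0 := by
  let L : ℕ → ℤ := fun M => 2 * (M + 1)
  let r : ℕ → (β × Fin (d + 1) → ℤ) → β × Fin (d + 1) → ℝ := fun M z x => z x / L M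
  have hr : ∀ M B z, r M (flipBlock B z) = flipBlock B (r M z) := by
    intro M B z
    funext x
    simp only [r, flipBlock]
    split_ifs
    · push_cast; ring
    · rfl
  have hL0 : ∀ M, 0 < L M := fun M => by positivity
  have hL0' : ∀ M, (0 : ℝ) < L M := fun M => by exact_mod_cast hL0 M
  have hcell := fun M => exists_cell_of_odd (L := L M) (even_two_mul _) (hL0 M)
    (fun B K z => f B K (r M z)) (fun B K z => by rw [hr, hodd])
    (fun B B' hB K z => by rw [hr, heven B B' hB])
  choose z hz hzL y y' hy hy' hyy using hcell
  let S : Set (β × Fin (d + 1) → ℝ) := {u | (∀ x, |u x| ≤ 1) ∧ ∀ B, ∃ i, |u (B, i)| = 1}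
  have hS : IsCompact S := by
    refine (isCompact_Icc (a := fun _ => (-1 : ℝ)) (b := fun _ => 1)).of_isClosed_subset ?_ ?_
    · have : S = (⋂ x, {u | |u x| ≤ 1}) ∩ ⋂ B, ⋃ i, {u | |u (B, i)| = 1} := by
        ext u
        simp [S]
      rw [this]
      refine (isClosed_iInter fun x => isClosed_le (by fun_prop) (by fun_prop)).inter
        (isClosed_iInter fun B => isClosed_iUnion_of_finite fun i =>
          isClosed_eq (by fun_prop) (by fun_prop))
    · intro u hu
      exact ⟨fun x => (abs_le.1 (hu.1 x)).1, fun x => (abs_le.1 (hu.1 x)).2⟩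
  have hzS : ∀ M, r M (z M) ∈ S := by
    intro M
    have habs : ∀ x, |r M (z M) x| = |((z M x : ℤ) : ℝ)| / L M := fun x => by
      rw [abs_div, abs_of_pos (hL0' M)]
    refine ⟨fun x => ?_, fun B => ?_⟩
    · rw [habs, div_le_one (hL0' M)]
      exact_mod_cast hzL M x
    · obtain ⟨i, hi⟩ := hz M B
      refine ⟨i, ?_⟩
      rw [habs, div_eq_one_iff_eq (hL0' M).ne']
      exact_mod_cast hi
  obtain ⟨u, hu, φ, hφ, hlim⟩ := hS.tendsto_subseq hzS
  have hL : Filter.Tendsto (fun M => 1 / ((L M : ℤ) : ℝ)) Filter.atTop (nhds 0) := by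
    refine squeeze_zero (fun M => (div_pos one_pos (hL0' M)).le) (fun M => ?_)
      tendsto_one_div_add_atTop_nhds_zero_nat
    refine one_div_le_one_div_of_le (by positivity) ?_
    simp only [L]
    push_cast
    linarith [(Nat.cast_nonneg M : (0 : ℝ) ≤ M)]
  have hface : ∀ w : ℕ → β × Fin (d + 1) → ℤ, (∀ M, IsFace (w M) (z M)) →
      Filter.Tendsto (fun M => r (φ M) (w (φ M))) Filter.atTop (nhds u) := by
    intro w hw
    have h0 : Filter.Tendsto (fun M => r (φ M) (w (φ M)) - r (φ M) (z (φ M))) Filter.atTop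
        (nhds 0) := by
      rw [tendsto_pi_nhds]
      intro x
      refine squeeze_zero_norm (fun M => ?_) (hL.comp hφ.tendsto_atTop)
      simp only [r, Pi.sub_apply, comp_apply]
      rw [← sub_div, norm_div, Real.norm_eq_abs, Real.norm_eq_abs, abs_of_pos (hL0' _)]
      refine div_le_div_of_nonneg_right ?_ (hL0' _).le
      have : |w (φ M) x - z (φ M) x| ≤ 1 := by
        rcases hw (φ M) x with h | h
        · simp [h]
        · exact h.2.le
      exact_mod_cast this
    simpa using h0.add hlim
  refine ⟨u, hu.1, hu.2, fun B K => ?_⟩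
  have h1 := ((hf B K).tendsto u).comp (hface _ fun M => hy M B K)
  have h2 := ((hf B K).tendsto u).comp (hface _ fun M => hy' M B K)
  have h3 := le_of_tendsto (h1.mul h2) (Filter.Eventually.of_forall fun M => hyy (φ M) B K)
  exact mul_self_eq_zero.1 (le_antisymm h3 (mul_self_nonneg _))

end BorsukUlam

section Cycle

theorem exists_cyclic_span {α V : Type*} [Fintype α] [AddCommGroup V] [Module ℝ V]
    (θ : α → ℝ) (hθ : Function.Injective θ) (P M : α → V) :
    ∃ σ : α → α, ∑ i, (P i - M i) ∈ Submodule.span ℝ (Set.range fun i => P i - M (σ i)) ∧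
      ∀ i k, (∑ l, if θ l < θ i then P l else if θ i < θ l then M l else 0) -
        (∑ l, if θ l < θ k then P l else if θ k < θ l then M l else 0) ∈
          Submodule.span ℝ (Set.range fun i => P i - M (σ i)) := by
  obtain hα | hα := isEmpty_or_nonempty α
  · exact ⟨id, by simp, fun i => hα.elim i⟩
  obtain ⟨m, hm⟩ := Nat.exists_eq_succ_of_ne_zero (Fintype.card_ne_zero (α := α))
  let _ : LinearOrder α := LinearOrder.lift' θ hθ
  have hlt : ∀ i k : α, θ i < θ k ↔ i < k := fun i k => Iff.rfl
  let e : Fin (m + 1) ≃o α := Fintype.orderIsoFinOfCardEq α hm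
  let σ : α → α := fun i => e (e.symm i + 1)
  set S := Submodule.span ℝ (Set.range fun i => P i - M (σ i)) with hS
  have hmem : ∀ t, P (e t) - M (e (t + 1)) ∈ S := fun t =>
    Submodule.subset_span ⟨e t, by simp [σ]⟩
  let g : Fin (m + 1) → V := fun t =>
    ∑ l, if l < t then P (e l) else if t < l then M (e l) else 0
  have hg : ∀ i, (∑ l, if θ l < θ i then P l else if θ i < θ l then M l else 0) = g (e.symm i) := by
    intro i
    rw [← e.toEquiv.sum_comp]
    refine Finset.sum_congr rfl fun l _ => ?_
    simp only [hlt, RelIso.coe_fn_toEquiv, ← e.lt_symm_apply, ← e.symm_apply_lt]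
  have hstep : ∀ t : Fin m, g t.succ - g t.castSucc ∈ S := by
    intro t
    have h1 : g t.succ - g t.castSucc = P (e t.castSucc) - M (e t.succ) := by
      simp only [g]
      rw [← Finset.sum_sub_distrib]
      have h2 : ∀ l : Fin (m + 1), ((if l < t.succ then P (e l) else if t.succ < l then M (e l)
          else 0) - if l < t.castSucc then P (e l) else if t.castSucc < l then M (e l) else 0) =
          (if l = t.castSucc then P (e l) else 0) - if l = t.succ then M (e l) else 0 := by
        intro l
        simp only [Fin.lt_def, Fin.ext_iff, Fin.val_succ, Fin.val_castSucc]
        rcases lt_trichotomy (l : ℕ) t with h | h | h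
        · simp [h, h.ne, h.trans (Nat.lt_succ_self _), show (l : ℕ) ≠ t + 1 by omega]
        · simp [h]
        · by_cases h' : (l : ℕ) = t + 1
          · simp [h']
          · simp [h', h.ne', h.not_gt, h, show ¬ (l : ℕ) < t + 1 by omega,
              show (t : ℕ) + 1 < l by omega]
      rw [Finset.sum_congr rfl fun l _ => h2 l, Finset.sum_sub_distrib]
      simp
    rw [h1]
    simpa [Fin.coeSucc_eq_succ] using hmem t.castSucc
  have hzero : ∀ t, g t - g 0 ∈ S := by
    intro t
    induction t using Fin.induction with
    | zero => simp
    | succ t ih => simpa using S.add_mem (hstep t) ih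
  refine ⟨σ, ?_, fun i k => ?_⟩
  · have h : ∑ i, (P i - M i) = ∑ t, (P (e t) - M (e (t + 1))) := by
      rw [Finset.sum_sub_distrib, Finset.sum_sub_distrib, ← e.toEquiv.sum_comp P,
        ← e.toEquiv.sum_comp M, ← Equiv.sum_comp (Equiv.addRight (1 : Fin (m + 1)))
          fun t => M (e.toEquiv t)]
      rfl
    rw [h]
    exact S.sum_mem fun t _ => hmem t
  · rw [hg, hg]
    simpa using S.sub_mem (hzero (e.symm i)) (hzero (e.symm k))

end Cycle

/-- The linear functional `f ↦ f t`. -/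
noncomputable def evalAt (t : ℝ) : C(ℝ, ℝ) →ₗ[ℝ] ℝ where
  toFun f := f t
  map_add' _ _ := rfl
  map_smul' _ _ := rfl

section Block

/-- The projection of the real line onto `[-1, 1]`. -/
noncomputable def clamp (t : ℝ) : ℝ := max (-1) (min 1 t)

theorem continuous_clamp : Continuous clamp := by unfold clamp; fun_prop

theorem clamp_neg (t : ℝ) : clamp (-t) = -clamp t := by unfold clamp; grind

theorem clamp_zero : clamp 0 = 0 := by unfold clamp; grind

theorem clamp_of_one_le {t : ℝ} (h : 1 ≤ t) : clamp t = 1 := by unfold clamp; grind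

theorem clamp_of_le_neg_one {t : ℝ} (h : t ≤ -1) : clamp t = -1 := by unfold clamp; grind

theorem abs_clamp_le (t : ℝ) : |clamp t| ≤ 1 := by unfold clamp; grind

variable {m : ℕ} (A : Fin m → ℝ) (h : ℝ) (u : Fin m → ℝ)

/-- The displacement of the `i`-th site. -/
noncomputable def displacement (i : Fin m) : ℝ := h * (clamp (u i) - clamp (2 * u i) / 2)

/-- The time at which the `i`-th site passes through its anchor. -/
noncomputable def crossTime (i : Fin m) : ℝ := (i + 1) * clamp (2 * u i)

/-- The position at time `θ` of a particle which moves from `A i - displacement h u i`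
to `A i + displacement h u i` around the time `crossTime u i`. -/
noncomputable def position (θ : ℝ) (i : Fin m) : ℝ :=
  A i + displacement h u i * clamp (2 * (θ - crossTime u i))

/-- The evaluation at the anchor `A j`, corrected by the total motion of the particles. -/
noncomputable def siteFunctional (j : Fin m) : C(ℝ, ℝ) →ₗ[ℝ] ℝ :=
  evalAt (A j) + ∑ i, (evalAt (A i) - evalAt (position A h u (crossTime u j) i))

/-- The total jump of the particles from the beginning to the end of the motion. -/
noncomputable def jumpFunctional : C(ℝ, ℝ) →ₗ[ℝ] ℝ :=
  ∑ i, (evalAt (A i + displacement h u i) - evalAt (A i - displacement h u i))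

theorem displacement_neg (i : Fin m) : displacement h (-u) i = -displacement h u i := by
  simp only [displacement, Pi.neg_apply, mul_neg, clamp_neg]
  ring

theorem crossTime_neg (i : Fin m) : crossTime (-u) i = -crossTime u i := by
  simp only [crossTime, Pi.neg_apply, mul_neg, clamp_neg]

theorem siteFunctional_neg (j : Fin m) : siteFunctional A h (-u) j = siteFunctional A h u j := by
  have : ∀ i, position A h (-u) (crossTime (-u) j) i = position A h u (crossTime u j) i := by
    intro i
    simp only [position, displacement_neg, crossTime_neg]
    rw [show 2 * (-crossTime u j - -crossTime u i) = -(2 * (crossTime u j - crossTime u i)) by ring,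
      clamp_neg]
    ring
  simp only [siteFunctional, this]

theorem jumpFunctional_neg : jumpFunctional A h (-u) = -jumpFunctional A h u := by
  simp only [jumpFunctional, displacement_neg]
  rw [← Finset.sum_neg_distrib]
  refine Finset.sum_congr rfl fun i _ => ?_
  rw [neg_sub, sub_neg_eq_add, ← sub_eq_add_neg]

theorem continuous_siteFunctional (j : Fin m) (f : C(ℝ, ℝ)) :
    Continuous fun u => siteFunctional A h u j f := by
  have hc := continuous_clamp
  simp only [siteFunctional, evalAt, position, crossTime, displacement, LinearMap.add_apply,
    LinearMap.sum_apply, LinearMap.sub_apply, LinearMap.coe_mk, AddHom.coe_mk]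
  fun_prop

theorem continuous_jumpFunctional (f : C(ℝ, ℝ)) : Continuous fun u => jumpFunctional A h u f := by
  have hc := continuous_clamp
  simp only [jumpFunctional, evalAt, displacement,
    LinearMap.sum_apply, LinearMap.sub_apply, LinearMap.coe_mk, AddHom.coe_mk]
  fun_prop

variable {h u}

theorem abs_displacement_le (hh : 0 ≤ h) (i : Fin m) : |displacement h u i| ≤ h := by
  have : |clamp (u i) - clamp (2 * u i) / 2| ≤ 1 := by unfold clamp; grind
  rw [displacement, abs_mul, abs_of_nonneg hh]
  exact mul_le_of_le_one_right hh this

theorem abs_position_sub_le (hh : 0 ≤ h) (θ : ℝ) (i : Fin m) :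
    |position A h u θ i - A i| ≤ h := by
  rw [position, add_sub_cancel_left, abs_mul]
  exact (mul_le_of_le_one_right (abs_nonneg _) (abs_clamp_le _)).trans (abs_displacement_le hh i)

theorem displacement_ne_zero (hh : 0 < h) {i : Fin m} (hi : |u i| = 1) :
    displacement h u i ≠ 0 := by
  have : clamp (u i) - clamp (2 * u i) / 2 ≠ 0 := by unfold clamp; grind
  exact mul_ne_zero hh.ne' this

theorem crossTime_of_displacement_ne_zero {i : Fin m} (hi : displacement h u i ≠ 0) :
    crossTime u i = i + 1 ∨ crossTime u i = -(i + 1) := by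
  have : clamp (2 * u i) = 1 ∨ clamp (2 * u i) = -1 := by
    have := right_ne_zero_of_mul hi
    unfold clamp at *
    grind
  rcases this with h | h <;> simp [crossTime, h]

theorem one_le_abs_crossTime_sub {i k : Fin m} (hik : i ≠ k) (hi : displacement h u i ≠ 0)
    (hk : displacement h u k ≠ 0) : 1 ≤ |crossTime u i - crossTime u k| := by
  have hv : (i : ℕ) ≠ k := fun h => hik (Fin.ext h)
  have key : ∀ a b : ℤ, a ≠ b → (1 : ℝ) ≤ |(a : ℝ) - b| := fun a b hab => by
    exact_mod_cast Int.one_le_abs (sub_ne_zero.2 hab)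
  rcases crossTime_of_displacement_ne_zero hi with h1 | h1 <;>
    rcases crossTime_of_displacement_ne_zero hk with h2 | h2 <;> rw [h1, h2]
  · exact_mod_cast key (i + 1) (k + 1) (by omega)
  · exact_mod_cast key (i + 1) (-(k + 1)) (by omega)
  · exact_mod_cast key (-(i + 1)) (k + 1) (by omega)
  · exact_mod_cast key (-(i + 1)) (-(k + 1)) (by omega)

theorem siteFunctional_sub_nearest {i : Fin m} (j : Fin m) (hi : displacement h u i ≠ 0)
    (hmin : ∀ k, displacement h u k ≠ 0 →
      |crossTime u j - crossTime u i| ≤ |crossTime u j - crossTime u k|) :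
    siteFunctional A h u j - siteFunctional A h u i =
      evalAt (A j) - evalAt (position A h u (crossTime u j) i) := by
  have hpos : ∀ k ≠ i, position A h u (crossTime u j) k = position A h u (crossTime u i) k := by
    intro k hk
    by_cases hd : displacement h u k = 0
    · simp [position, hd]
    · have h1 := one_le_abs_crossTime_sub hk.symm hi hd
      have h2 := hmin k hd
      unfold position
      congr 2
      rcases le_total (crossTime u k) (crossTime u i) with h3 | h3
      · rw [clamp_of_one_le, clamp_of_one_le] <;> grind
      · rw [clamp_of_le_neg_one, clamp_of_le_neg_one] <;> grind
  have hself : position A h u (crossTime u i) i = A i := by simp [position, clamp_zero]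
  unfold siteFunctional
  rw [add_sub_add_comm, ← Finset.sum_sub_distrib, Finset.sum_eq_single i]
  · rw [hself]
    abel
  · intro k _ hk
    rw [hpos k hk, sub_self]
  · simp

theorem sum_eq_sum_displaced {V : Type*} [AddCommMonoid V] (f : Fin m → V)
    (hf : ∀ l, displacement h u l = 0 → f l = 0) :
    ∑ l, f l = ∑ l : {l // displacement h u l ≠ 0}, f l := by
  rw [← Finset.sum_filter_of_ne (p := fun l => displacement h u l ≠ 0)
    fun l _ hl h0 => hl (hf l h0)]
  exact Finset.sum_subtype _ (by simp) f

theorem siteFunctional_of_displacement_ne_zero {i : Fin m} (hi : displacement h u i ≠ 0) :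
    siteFunctional A h u i = (∑ l : {l // displacement h u l ≠ 0}, evalAt (A l)) -
      ∑ l : {l // displacement h u l ≠ 0}, if crossTime u l < crossTime u i then
        evalAt (A l + displacement h u l) else if crossTime u i < crossTime u l then
        evalAt (A l - displacement h u l) else 0 := by
  classical
  have hpos : ∀ l : {l // displacement h u l ≠ 0},
      (evalAt (A l) - evalAt (position A h u (crossTime u i) l)) =
      evalAt (A l) - (if crossTime u l < crossTime u i then
        evalAt (A l + displacement h u l) else if crossTime u i < crossTime u l then
        evalAt (A l - displacement h u l) else 0) -
        if l = ⟨i, hi⟩ then evalAt (A i) else 0 := by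
    rintro ⟨l, hl⟩
    by_cases hli : l = i
    · subst hli
      simp [position, clamp_zero]
    · have h1 := one_le_abs_crossTime_sub hli hl hi
      rw [if_neg (c := (⟨l, hl⟩ : {l // displacement h u l ≠ 0}) = ⟨i, hi⟩) (by simpa using hli),
        sub_zero]
      rcases le_total (crossTime u l) (crossTime u i) with h3 | h3
      · rw [if_pos (by grind), position, clamp_of_one_le (by grind), mul_one]
      · rw [if_neg (by grind), if_pos (by grind), position, clamp_of_le_neg_one (by grind),
          mul_neg_one, ← sub_eq_add_neg]
  have hsum := sum_eq_sum_displaced (h := h) (u := u)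
    (fun l => evalAt (A l) - evalAt (position A h u (crossTime u i) l))
    (fun l hl => by simp [position, hl])
  rw [siteFunctional, hsum, Finset.sum_congr rfl fun l _ => hpos l, Finset.sum_sub_distrib,
    Finset.sum_sub_distrib, Finset.sum_ite_eq']
  simp

theorem exists_chords_span (hu : ∃ i, displacement h u i ≠ 0) :
    ∃ a b : Fin m → ℝ,
      jumpFunctional A h u ∈ Submodule.span ℝ (Set.range fun i => evalDiff (a i) (b i)) ∧
      ∀ j k, siteFunctional A h u j - siteFunctional A h u k ∈
        Submodule.span ℝ (Set.range fun i => evalDiff (a i) (b i)) := by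
  classical
  have hdiff : ∀ a b, evalDiff a b = evalAt b - evalAt a := fun a b => rfl
  have hinj : Function.Injective
      fun l : {l // displacement h u l ≠ 0} => crossTime u l := by
    intro l k hlk
    by_contra hne
    have := one_le_abs_crossTime_sub (fun h => hne (Subtype.ext h)) l.2 k.2
    simp only at hlk
    norm_num [hlk] at this
  obtain ⟨σ, hσ1, hσ2⟩ := exists_cyclic_span _ hinj
    (fun l => evalAt (A l + displacement h u l)) (fun l => evalAt (A l - displacement h u l))
  have : Nonempty {l // displacement h u l ≠ 0} := nonempty_subtype.2 hu
  have hnear : ∀ j, ∃ i : {l // displacement h u l ≠ 0}, ∀ k : {l // displacement h u l ≠ 0},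
      |crossTime u j - crossTime u i| ≤ |crossTime u j - crossTime u k| := fun j =>
    Finite.exists_min fun i : {l // displacement h u l ≠ 0} => |crossTime u j - crossTime u i|
  choose near hnear using hnear
  refine ⟨fun i => if hi : displacement h u i ≠ 0 then
      A (σ ⟨i, hi⟩) - displacement h u (σ ⟨i, hi⟩) else
      position A h u (crossTime u i) (near i),
    fun i => if displacement h u i ≠ 0 then A i + displacement h u i else A i, ?_⟩
  set S := Submodule.span ℝ (Set.range fun i => evalDiff (if hi : displacement h u i ≠ 0 then
      A (σ ⟨i, hi⟩) - displacement h u (σ ⟨i, hi⟩) else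
      position A h u (crossTime u i) (near i))
      (if displacement h u i ≠ 0 then A i + displacement h u i else A i)) with hS
  have hle : Submodule.span ℝ (Set.range fun l : {l // displacement h u l ≠ 0} =>
      evalAt (A l + displacement h u l) - evalAt (A (σ l) - displacement h u (σ l))) ≤ S := by
    rw [Submodule.span_le]
    rintro _ ⟨l, rfl⟩
    refine Submodule.subset_span ⟨l, ?_⟩
    simp [l.2, hdiff]
  have hact : ∀ i k : {l // displacement h u l ≠ 0},
      siteFunctional A h u i - siteFunctional A h u k ∈ S := by
    intro i k
    rw [siteFunctional_of_displacement_ne_zero A i.2, siteFunctional_of_displacement_ne_zero A k.2,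
      sub_sub_sub_cancel_left]
    exact hle (hσ2 k i)
  have hall : ∀ j, siteFunctional A h u j - siteFunctional A h u (near j) ∈ S := by
    intro j
    by_cases hj : displacement h u j ≠ 0
    · exact hact ⟨j, hj⟩ (near j)
    · rw [siteFunctional_sub_nearest A j (near j).2 fun k hk => hnear j ⟨k, hk⟩]
      refine Submodule.subset_span ⟨j, ?_⟩
      simp only [hdiff, dif_neg hj, if_neg hj]
  refine ⟨?_, fun j k => ?_⟩
  · rw [jumpFunctional, sum_eq_sum_displaced (h := h) (u := u) _ fun l hl => by simp [hl]]
    exact hle hσ1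
  · have := S.add_mem (S.sub_mem (hall j) (hall k)) (hact (near j) (near k))
    convert this using 1
    abel

end Block

section Interpolation

open Module

theorem evalAt_apply (t : ℝ) (f : C(ℝ, ℝ)) : evalAt t f = f t := rfl

theorem exists_points {ι : Type*} [Fintype ι] (F : Submodule ℝ C(ℝ, ℝ)) [FiniteDimensional ℝ F]
    (hF : finrank ℝ F = Fintype.card ι) :
    ∃ t : ι → ℝ, ∀ f ∈ F, (∀ p, f (t p) = 0) → f = 0 := by
  let E : ℝ → Dual ℝ F := fun t => (evalAt t).comp F.subtype
  have hco : (Submodule.span ℝ (Set.range E)).dualCoannihilator = ⊥ := by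
    rw [eq_bot_iff]
    intro f hf
    rw [Submodule.mem_dualCoannihilator] at hf
    rw [Submodule.mem_bot]
    ext t
    exact hf (E t) (Submodule.subset_span ⟨t, rfl⟩)
  have hrank : finrank ℝ (Submodule.span ℝ (Set.range E)) = Fintype.card ι := by
    have := Subspace.finrank_add_finrank_dualCoannihilator_eq (Submodule.span ℝ (Set.range E))
    rwa [hco, finrank_bot, add_zero, hF] at this
  obtain ⟨g, hg, hspan, -⟩ := Submodule.exists_fun_fin_finrank_span_eq ℝ (Set.range E)
  choose t ht using hg
  let e := (Fintype.equivFinOfCardEq hrank.symm)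
  refine ⟨t ∘ e, fun f hf h0 => ?_⟩
  have hmem : (⟨f, hf⟩ : F) ∈ (Submodule.span ℝ (Set.range E)).dualCoannihilator := by
    rw [← hspan, Submodule.mem_dualCoannihilator]
    intro φ hφ
    induction hφ using Submodule.span_induction with
    | mem φ h =>
      obtain ⟨i, rfl⟩ := h
      rw [← ht i]
      change f (t i) = 0
      simpa using h0 (e.symm i)
    | zero => rfl
    | add φ ψ _ _ h1 h2 => rw [LinearMap.add_apply, h1, h2, add_zero]
    | smul c φ _ h => rw [LinearMap.smul_apply, h, smul_zero]
  rw [hco, Submodule.mem_bot] at hmem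
  exact congrArg Subtype.val hmem

theorem exists_interpolation {ι : Type*} [Fintype ι] [DecidableEq ι] (F : Submodule ℝ C(ℝ, ℝ))
    [FiniteDimensional ℝ F] (hF : finrank ℝ F = Fintype.card ι) :
    ∃ (t : ι → ℝ) (f : ι → C(ℝ, ℝ)), (∀ q, f q ∈ F) ∧
      ∀ p q, f q (t p) = if p = q then 1 else 0 := by
  obtain ⟨t, ht⟩ := exists_points (ι := ι) F hF
  let Φ : F →ₗ[ℝ] (ι → ℝ) := LinearMap.pi fun p => (evalAt (t p)).comp F.subtype
  have hinj : Function.Injective Φ := by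
    rw [← LinearMap.ker_eq_bot, eq_bot_iff]
    intro f hf
    exact Subtype.ext (ht f f.2 fun p => congrFun hf p)
  have hsurj := (LinearMap.injective_iff_surjective_of_finrank_eq_finrank
    (by rw [hF, finrank_fintype_fun_eq_card])).1 hinj
  choose g hg using hsurj
  refine ⟨t, fun q => g (Pi.single q 1), fun q => (g _).2, fun p q => ?_⟩
  exact (congrFun (hg (Pi.single q 1)) p).trans (Pi.single_apply _ _ _)

theorem exists_notMem (F : Submodule ℝ C(ℝ, ℝ)) [FiniteDimensional ℝ F] : ∃ f, f ∉ F := by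
  obtain ⟨t, ht⟩ := exists_points (ι := Fin (finrank ℝ F)) F (by simp)
  obtain ⟨x, hx⟩ := Infinite.exists_notMem_finset (Finset.univ.image t)
  let g : C(ℝ, ℝ) := ⟨fun y => ∏ p, (y - t p), by fun_prop⟩
  refine ⟨g, fun hg => ?_⟩
  have h0 := ht g hg fun p => Finset.prod_eq_zero (Finset.mem_univ p) (sub_self _)
  have h1 : ∏ p, (x - t p) = 0 := DFunLike.congr_fun h0 x
  obtain ⟨p, -, hp⟩ := Finset.prod_eq_zero_iff.1 h1
  exact hx (Finset.mem_image.2 ⟨p, Finset.mem_univ p, (sub_eq_zero.1 hp).symm⟩)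

theorem exists_le_finrank_succ (F : Submodule ℝ C(ℝ, ℝ)) [FiniteDimensional ℝ F] :
    ∃ F' : Submodule ℝ C(ℝ, ℝ), F ≤ F' ∧ FiniteDimensional ℝ F' ∧
      finrank ℝ F' = finrank ℝ F + 1 := by
  obtain ⟨f, hf⟩ := exists_notMem F
  have hf0 : f ≠ 0 := fun h => hf (h ▸ F.zero_mem)
  refine ⟨F ⊔ Submodule.span ℝ {f}, le_sup_left, inferInstance, ?_⟩
  have h1 := Submodule.finrank_sup_add_finrank_inf_eq F (Submodule.span ℝ {f})
  have h2 : F ⊓ Submodule.span ℝ {f} = ⊥ := by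
    rw [← disjoint_iff]
    exact (Submodule.disjoint_span_singleton' hf0).2 hf
  rwa [h2, finrank_bot, add_zero, finrank_span_singleton hf0] at h1

end Interpolation

section Independence

open Module

theorem linearIndependent_of_dual {ι V : Type*} [Fintype ι] [AddCommGroup V] [Module ℝ V]
    (w : ι → V →ₗ[ℝ] ℝ) (T : ι → V) (h0 : ∀ i k, i ≠ k → w i (T k) = 0)
    (h1 : ∀ i, w i (T i) ≠ 0) : LinearIndependent ℝ w := by
  rw [Fintype.linearIndependent_iff]
  intro g hg i
  have := LinearMap.congr_fun hg (T i)
  rw [LinearMap.sum_apply, Finset.sum_eq_single i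
    (fun k _ hk => by rw [LinearMap.smul_apply, h0 k i hk, smul_zero]) (by simp)] at this
  simpa [h1 i] using this

/-- The jumps of the blocks and the differences of the site functionals inside each block and
inside the remaining sites. -/
def blockDifferences {β V : Type*} {d r : ℕ} [AddCommGroup V] (v : β → V)
    (γ : (β × Fin (d + 1)) ⊕ Fin (r + 1) → V) : (β × Fin (d + 1)) ⊕ Fin r → V :=
  Sum.elim (fun x => if x.2 = 0 then v x.1 else γ (Sum.inl x) - γ (Sum.inl (x.1, 0)))
    (fun e => γ (Sum.inr e.succ) - γ (Sum.inr 0))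

theorem linearIndependent_blockDifferences {β V : Type*} [Fintype β] [DecidableEq β] {d r : ℕ}
    [AddCommGroup V] [Module ℝ V] (v : β → V →ₗ[ℝ] ℝ)
    (γ : (β × Fin (d + 1)) ⊕ Fin (r + 1) → V →ₗ[ℝ] ℝ)
    (bump : (β × Fin (d + 1)) ⊕ Fin (r + 1) → V) (ramp : β → V)
    (hγ : ∀ p q, γ p (bump q) = if p = q then 1 else 0) (hv : ∀ B q, v B (bump q) = 0)
    (hramp : ∀ B B', B ≠ B' → v B (ramp B') = 0) (hramp0 : ∀ B, v B (ramp B) ≠ 0) :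
    LinearIndependent ℝ (blockDifferences v γ) := by
  let ramp' : β → V := fun B => ramp B - ∑ q, γ q (ramp B) • bump q
  have h1 : ∀ p B, γ p (ramp' B) = 0 := by
    intro p B
    simp [ramp', hγ, -Fintype.sum_sum_type]
  have h2 : ∀ B B', v B (ramp' B') = v B (ramp B') := by
    intro B B'
    simp [ramp', hv]
  refine linearIndependent_of_dual _ (Sum.elim (fun x => if x.2 = 0 then ramp' x.1 else
    bump (Sum.inl x)) (fun e => bump (Sum.inr e.succ))) ?_ ?_
  · rintro (⟨B, j⟩ | e) (⟨B', j'⟩ | e') hne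
    · by_cases hj : j = 0 <;> by_cases hj' : j' = 0
      · have : B ≠ B' := fun h => hne (by rw [h, hj, hj'])
        simp [blockDifferences, hj, hj', h2, hramp _ _ this]
      · simp [blockDifferences, hj, hj', hv]
      · simp [blockDifferences, hj, hj', h1]
      · have h3 : ¬ (B = B' ∧ j = j') := fun h => hne (by rw [h.1, h.2])
        simp [blockDifferences, hj, hj', hγ, h3, Ne.symm hj']
    · by_cases hj : j = 0 <;> simp [blockDifferences, hj, hv, hγ]
    · by_cases hj' : j' = 0 <;> simp [blockDifferences, hj', h1, hγ]
    · have : e ≠ e' := fun h => hne (by rw [h])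
      simp [blockDifferences, hγ, this, (Fin.succ_ne_zero e').symm]
  · rintro (⟨B, j⟩ | e)
    · by_cases hj : j = 0
      · simpa [blockDifferences, hj, h2] using hramp0 B
      · simp [blockDifferences, hj, hγ, Ne.symm hj]
    · simp [blockDifferences, hγ, (Fin.succ_ne_zero e).symm]

end Independence

section Bump

open Module

/-- A plateau of height `1` over the `h`-neighbourhood of `A`. -/
noncomputable def bump (A h : ℝ) : C(ℝ, ℝ) :=
  ⟨fun y => max 0 (min 1 (2 - |y - A| / h)), by fun_prop⟩

theorem bump_eq_one {A h y : ℝ} (hh : 0 < h) (hy : |y - A| ≤ h) : bump A h y = 1 := by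
  have : |y - A| / h ≤ 1 := (div_le_one hh).2 hy
  change max 0 (min 1 (2 - |y - A| / h)) = 1
  grind

theorem bump_eq_zero {A h y : ℝ} (hh : 0 < h) (hy : 2 * h ≤ |y - A|) : bump A h y = 0 := by
  have : 2 ≤ |y - A| / h := (le_div_iff₀ hh).2 hy
  change max 0 (min 1 (2 - |y - A| / h)) = 0
  grind

/-- The function `y ↦ y - A` cut off outside a neighbourhood of `A`. -/
noncomputable def ramp (A h : ℝ) : C(ℝ, ℝ) := ⟨fun y => (y - A) * bump A h y, by fun_prop⟩

theorem bump_near {ι : Type*} [DecidableEq ι] {t : ι → ℝ} {h : ℝ} (hh : 0 < h)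
    (hsep : ∀ p q, p ≠ q → 3 * h ≤ |t p - t q|) {p : ι} (q : ι) {y : ℝ} (hy : |y - t p| ≤ h) :
    bump (t q) h y = if p = q then 1 else 0 := by
  by_cases hpq : p = q
  · subst hpq
    rw [bump_eq_one hh hy, if_pos rfl]
  · rw [if_neg hpq]
    refine bump_eq_zero hh ?_
    have := hsep p q hpq
    grind

theorem ramp_near {ι : Type*} [DecidableEq ι] {t : ι → ℝ} {h : ℝ} (hh : 0 < h)
    (hsep : ∀ p q, p ≠ q → 3 * h ≤ |t p - t q|) {p : ι} (q : ι) {y : ℝ} (hy : |y - t p| ≤ h) :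
    ramp (t q) h y = if p = q then y - t q else 0 := by
  change (y - t q) * bump (t q) h y = _
  rw [bump_near hh hsep q hy]
  split_ifs <;> simp

end Bump

section Perturbation

open Module

variable {ι : Type*} [Fintype ι]

theorem exists_pos_det_ne_zero [DecidableEq ι] : ∃ ε > 0, ∀ M : Matrix ι ι ℝ,
    (∀ p q, |M p q - (1 : Matrix ι ι ℝ) p q| < ε) → M.det ≠ 0 := by
  have hopen : IsOpen {M : ι → ι → ℝ | (Matrix.of M).det ≠ 0} :=
    isOpen_ne_fun (Continuous.matrix_det continuous_id) continuous_const
  obtain ⟨ε, hε, hball⟩ := Metric.isOpen_iff.1 hopen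
    (fun p q => (1 : Matrix ι ι ℝ) p q) (show (1 : Matrix ι ι ℝ).det ≠ 0 by simp)
  refine ⟨ε, hε, fun M hM => hball (a := fun p q => M p q) (Metric.mem_ball.2 ?_)⟩
  exact (dist_pi_lt_iff hε).2 fun p => (dist_pi_lt_iff hε).2 fun q => hM p q

theorem exists_scale (t : ι → ℝ) (ht : Function.Injective t) (f : ι → C(ℝ, ℝ)) {ε : ℝ}
    (hε : 0 < ε) : ∃ h > 0, (∀ p q, p ≠ q → 3 * h ≤ |t p - t q|) ∧
      ∀ p q y, |y - t p| ≤ h → |f q y - f q (t p)| ≤ ε := by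
  have h1 : ∀ᶠ h : ℝ in nhdsWithin 0 (Set.Ioi 0), ∀ p q, p ≠ q → 3 * h ≤ |t p - t q| := by
    simp only [Filter.eventually_all]
    intro p q hpq
    have hpos : 0 < |t p - t q| / 3 := by
      have := abs_pos.2 (sub_ne_zero.2 (ht.ne hpq))
      positivity
    filter_upwards [Ioo_mem_nhdsGT hpos] with h hh
    linarith [hh.2]
  have h2 : ∀ᶠ h : ℝ in nhdsWithin 0 (Set.Ioi 0),
      ∀ p q y, |y - t p| ≤ h → |f q y - f q (t p)| ≤ ε := by
    simp only [Filter.eventually_all (ι := ι)]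
    intro p q
    obtain ⟨δ, hδ, hf⟩ := Metric.continuous_iff.1 (f q).continuous (t p) ε hε
    filter_upwards [Ioo_mem_nhdsGT hδ] with h hh y hy
    exact (hf y (hy.trans_lt hh.2)).le
  obtain ⟨h, ⟨h1, h2⟩, h0⟩ := ((h1.and h2).and self_mem_nhdsWithin).exists
  exact ⟨h, h0, h1, h2⟩

theorem continuous_matrix_inv [DecidableEq ι] {X : Type*} [TopologicalSpace X]
    {M : X → Matrix ι ι ℝ} (hM : Continuous M) (h0 : ∀ x, (M x).det ≠ 0) :
    Continuous fun x => (M x)⁻¹ := by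
  simp only [Matrix.inv_def, Ring.inverse_eq_inv']
  exact (hM.matrix_det.inv₀ h0).smul hM.matrix_adjugate

end Perturbation

section Assembly

open Module

variable {β : Type*} {d r : ℕ} (t : (β × Fin (d + 1)) ⊕ Fin (r + 1) → ℝ) (h : ℝ)
  (u : β × Fin (d + 1) → ℝ)

/-- The functionals attached to the sites: corrected evaluations inside the blocks and plain
evaluations elsewhere. -/
noncomputable def blockSite (p : (β × Fin (d + 1)) ⊕ Fin (r + 1)) : C(ℝ, ℝ) →ₗ[ℝ] ℝ :=
  p.elim (fun x => siteFunctional (fun i => t (Sum.inl (x.1, i))) h (fun i => u (x.1, i)) x.2)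
    (fun e => evalAt (t (Sum.inr e)))

/-- The total jump of a block. -/
noncomputable def blockJump (B : β) : C(ℝ, ℝ) →ₗ[ℝ] ℝ :=
  jumpFunctional (fun i => t (Sum.inl (B, i))) h fun i => u (B, i)

theorem flipBlock_self [DecidableEq β] (B : β) :
    (fun i => flipBlock B u (B, i)) = -fun i => u (B, i) := by
  funext i
  simp [flipBlock]

theorem flipBlock_of_ne [DecidableEq β] {B B' : β} (hB : B' ≠ B) :
    (fun i => flipBlock B' u (B, i)) = fun i => u (B, i) := by
  funext i
  simp [flipBlock, hB.symm]

theorem blockSite_flipBlock [DecidableEq β] (B : β) (p : (β × Fin (d + 1)) ⊕ Fin (r + 1)) :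
    blockSite t h (flipBlock B u) p = blockSite t h u p := by
  rcases p with ⟨B', j⟩ | e
  · by_cases hB : B = B'
    · subst hB
      simp only [blockSite, Sum.elim_inl, flipBlock_self, siteFunctional_neg]
    · simp only [blockSite, Sum.elim_inl, flipBlock_of_ne u hB]
  · rfl

theorem blockJump_flipBlock_self [DecidableEq β] (B : β) :
    blockJump t h (flipBlock B u) B = -blockJump t h u B := by
  rw [blockJump, flipBlock_self, jumpFunctional_neg, blockJump]

theorem blockJump_flipBlock_of_ne [DecidableEq β] {B B' : β} (hB : B' ≠ B) :
    blockJump t h (flipBlock B' u) B = blockJump t h u B := by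
  rw [blockJump, flipBlock_of_ne u hB, blockJump]

theorem continuous_blockSite (p : (β × Fin (d + 1)) ⊕ Fin (r + 1)) (f : C(ℝ, ℝ)) :
    Continuous fun u => blockSite t h u p f := by
  rcases p with ⟨B, j⟩ | e
  · have hu : Continuous fun (u : β × Fin (d + 1) → ℝ) (i : Fin (d + 1)) => u (B, i) := by fun_prop
    exact (continuous_siteFunctional (fun i => t (Sum.inl (B, i))) h j f).comp hu
  · exact continuous_const

theorem continuous_blockJump (B : β) (f : C(ℝ, ℝ)) :
    Continuous fun u => blockJump t h u B f := by
  have hu : Continuous fun (u : β × Fin (d + 1) → ℝ) (i : Fin (d + 1)) => u (B, i) := by fun_prop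
  exact (continuous_jumpFunctional (fun i => t (Sum.inl (B, i))) h f).comp hu

variable {t h}

theorem abs_blockSite_sub_le (hh : 0 ≤ h) {f : C(ℝ, ℝ)} {ε : ℝ} (hε : 0 ≤ ε)
    (hf : ∀ p y, |y - t p| ≤ h → |f y - f (t p)| ≤ ε) (p : (β × Fin (d + 1)) ⊕ Fin (r + 1)) :
    |blockSite t h u p f - f (t p)| ≤ (d + 1) * ε := by
  rcases p with ⟨B, j⟩ | e
  · have h1 : blockSite t h u (Sum.inl (B, j)) f - f (t (Sum.inl (B, j))) =
        ∑ i, (f (t (Sum.inl (B, i))) - f (position (fun i => t (Sum.inl (B, i))) h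
          (fun i => u (B, i)) (crossTime (fun i => u (B, i)) j) i)) := by
      simp [blockSite, siteFunctional, evalAt_apply]
    rw [h1]
    refine (Finset.abs_sum_le_sum_abs _ _).trans ?_
    refine (Finset.sum_le_card_nsmul _ _ ε fun i _ => ?_).trans (by simp)
    rw [abs_sub_comm]
    exact hf _ _ (abs_position_sub_le (fun i => t (Sum.inl (B, i))) hh _ i)
  · rw [show blockSite t h u (Sum.inr e) f = f (t (Sum.inr e)) from rfl, sub_self, abs_zero]
    positivity

theorem abs_displaced_sub_le (hh : 0 ≤ h) (B : β) (i : Fin (d + 1)) :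
    |t (Sum.inl (B, i)) + displacement h (fun i => u (B, i)) i - t (Sum.inl (B, i))| ≤ h ∧
    |t (Sum.inl (B, i)) - displacement h (fun i => u (B, i)) i - t (Sum.inl (B, i))| ≤ h := by
  rw [add_sub_cancel_left, sub_sub_cancel_left, abs_neg]
  exact ⟨abs_displacement_le hh i, abs_displacement_le hh i⟩

variable [DecidableEq β]

theorem blockSite_bump (hh : 0 < h) (hsep : ∀ p q, p ≠ q → 3 * h ≤ |t p - t q|)
    (p q : (β × Fin (d + 1)) ⊕ Fin (r + 1)) :
    blockSite t h u p (bump (t q) h) = if p = q then 1 else 0 := by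
  have h0 : ∀ p, bump (t q) h (t p) = if p = q then 1 else 0 := fun p =>
    bump_near hh hsep q (by simpa using hh.le)
  rcases p with ⟨B, j⟩ | e
  · have h1 : ∀ i, bump (t q) h (position (fun i => t (Sum.inl (B, i))) h
        (fun i => u (B, i)) (crossTime (fun i => u (B, i)) j) i) =
          bump (t q) h (t (Sum.inl (B, i))) := fun i => by
      rw [h0]
      exact bump_near hh hsep q (abs_position_sub_le _ hh.le _ i)
    simp [blockSite, siteFunctional, evalAt_apply, h1, h0]
  · exact h0 _

theorem blockJump_bump (hh : 0 < h) (hsep : ∀ p q, p ≠ q → 3 * h ≤ |t p - t q|) (B : β)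
    (q : (β × Fin (d + 1)) ⊕ Fin (r + 1)) : blockJump t h u B (bump (t q) h) = 0 := by
  simp only [blockJump, jumpFunctional, LinearMap.sum_apply, LinearMap.sub_apply, evalAt_apply]
  refine Finset.sum_eq_zero fun i _ => ?_
  have := abs_displaced_sub_le (t := t) u hh.le B i
  rw [bump_near hh hsep q this.1, bump_near hh hsep q this.2, sub_self]

theorem blockJump_ramp (hh : 0 < h) (hsep : ∀ p q, p ≠ q → 3 * h ≤ |t p - t q|) (B B' : β)
    (k : Fin (d + 1)) : blockJump t h u B (ramp (t (Sum.inl (B', k))) h) =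
      if B = B' then 2 * displacement h (fun i => u (B, i)) k else 0 := by
  simp only [blockJump, jumpFunctional, LinearMap.sum_apply, LinearMap.sub_apply, evalAt_apply]
  have h1 : ∀ i, ramp (t (Sum.inl (B', k))) h (t (Sum.inl (B, i)) +
      displacement h (fun i => u (B, i)) i) - ramp (t (Sum.inl (B', k))) h (t (Sum.inl (B, i)) -
      displacement h (fun i => u (B, i)) i) =
      if i = k then if B = B' then 2 * displacement h (fun i => u (B, i)) k else 0 else 0 := by
    intro i
    have := abs_displaced_sub_le (t := t) u hh.le B i
    rw [ramp_near hh hsep _ this.1, ramp_near hh hsep _ this.2]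
    by_cases hB : B = B' <;> by_cases hi : i = k <;> simp [hB, hi]
    ring
  rw [Finset.sum_congr rfl fun i _ => h1 i, Finset.sum_ite_eq']
  simp

end Assembly

section Main

open Module

/-- The combination of the `f q` on which the `p`-th row of `M` takes the value `g p`. -/
noncomputable def solve {ι V : Type*} [Fintype ι] [DecidableEq ι] [AddCommGroup V] [Module ℝ V]
    (M : Matrix ι ι ℝ) (f : ι → V) (g : ι → ℝ) : V := ∑ q, (M⁻¹.mulVec g) q • f q

theorem apply_solve {ι V : Type*} [Fintype ι] [DecidableEq ι] [AddCommGroup V] [Module ℝ V]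
    (γ : ι → V →ₗ[ℝ] ℝ) (f : ι → V) (g : ι → ℝ)
    (hM : (Matrix.of fun p q => γ p (f q)).det ≠ 0) (p : ι) :
    γ p (solve (Matrix.of fun p q => γ p (f q)) f g) = g p := by
  set M : Matrix ι ι ℝ := Matrix.of fun p q => γ p (f q) with hMdef
  have h1 : M.mulVec (M⁻¹.mulVec g) = g := by
    rw [Matrix.mulVec_mulVec, Matrix.mul_nonsing_inv _ (isUnit_iff_ne_zero.2 hM),
      Matrix.one_mulVec]
  rw [← congrFun h1 p, solve, map_sum]
  refine Finset.sum_congr rfl fun q _ => ?_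
  rw [map_smul, smul_eq_mul, mul_comm]
  rfl

variable {β : Type*} [Fintype β] [DecidableEq β] {d r : ℕ}

/-- The part of the partition of the sites to which a site belongs. -/
def siteClass (c : Option β → Fin d) : (β × Fin (d + 1)) ⊕ Fin (r + 1) → Fin d :=
  Sum.elim (fun x => c (some x.1)) fun _ => c none

theorem exists_config_common_zero (c : Option β → Fin d)
    (t : (β × Fin (d + 1)) ⊕ Fin (r + 1) → ℝ) (h : ℝ)
    (f : (β × Fin (d + 1)) ⊕ Fin (r + 1) → C(ℝ, ℝ))
    (hdet : ∀ u, (Matrix.of fun p q => blockSite t h u p (f q)).det ≠ 0) :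
    ∃ u : β × Fin (d + 1) → ℝ, (∀ B, ∃ i, |u (B, i)| = 1) ∧ ∀ B K, blockJump t h u B
      (solve (Matrix.of fun p q => blockSite t h u p (f q)) f
        fun p => if siteClass c p = K then 1 else 0) = 0 := by
  suffices hs : _ ∧ _ ∧ _ by
    obtain ⟨u, -, hu⟩ := exists_common_zero (fun B K u => blockJump t h u B
      (solve (Matrix.of fun p q => blockSite t h u p (f q)) f
        fun p => if siteClass c p = K then 1 else 0)) hs.1 hs.2.1 hs.2.2
    exact ⟨u, hu⟩
  refine ⟨?_, ?_, ?_⟩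
  · intro B K
    simp only [solve, map_sum, map_smul, smul_eq_mul]
    have hinv := continuous_matrix_inv (continuous_matrix fun p q =>
      continuous_blockSite t h p (f q)) hdet
    refine continuous_finsetSum _ fun q _ => Continuous.mul ?_ (continuous_blockJump t h B _)
    exact (continuous_apply q).comp (hinv.matrix_mulVec continuous_const)
  · intro B K u
    simp only [blockSite_flipBlock, blockJump_flipBlock_self, LinearMap.neg_apply]
  · intro B B' hB K u
    simp only [blockSite_flipBlock, blockJump_flipBlock_of_ne t h u hB]

theorem exists_independent_chords_of_localized {t : (β × Fin (d + 1)) ⊕ Fin (r + 1) → ℝ} {h : ℝ}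
    (hh : 0 < h) (hsep : ∀ p q, p ≠ q → 3 * h ≤ |t p - t q|) {u : β × Fin (d + 1) → ℝ}
    (hu : ∀ B, ∃ i, |u (B, i)| = 1) :
    ∃ a b : (β × Fin (d + 1)) ⊕ Fin r → ℝ,
      LinearIndependent ℝ (fun i => evalDiff (a i) (b i)) ∧
      Submodule.span ℝ (Set.range fun i => evalDiff (a i) (b i)) =
        Submodule.span ℝ (Set.range (blockDifferences (blockJump t h u) (blockSite t h u))) := by
  choose k hk using hu
  have hdisp : ∀ B, displacement h (fun i => u (B, i)) (k B) ≠ 0 := fun B =>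
    displacement_ne_zero hh (hk B)
  have hind : LinearIndependent ℝ (blockDifferences (blockJump t h u) (blockSite t h u)) := by
    refine linearIndependent_blockDifferences _ _ (fun q => bump (t q) h)
      (fun B => ramp (t (Sum.inl (B, k B))) h) (blockSite_bump u hh hsep)
      (blockJump_bump u hh hsep) (fun B B' hB => ?_) fun B => ?_
    · rw [blockJump_ramp u hh hsep, if_neg hB]
    · rw [blockJump_ramp u hh hsep, if_pos rfl]
      exact mul_ne_zero two_ne_zero (hdisp B)
  have hchords := fun B => exists_chords_span (fun i => t (Sum.inl (B, i))) ⟨k B, hdisp B⟩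
  choose a b hjump hsite using hchords
  let a' : (β × Fin (d + 1)) ⊕ Fin r → ℝ :=
    Sum.elim (fun x => a x.1 x.2) fun _ => t (Sum.inr 0)
  let b' : (β × Fin (d + 1)) ⊕ Fin r → ℝ :=
    Sum.elim (fun x => b x.1 x.2) fun e => t (Sum.inr e.succ)
  have hle : Submodule.span ℝ
      (Set.range (blockDifferences (blockJump t h u) (blockSite t h u))) ≤
      Submodule.span ℝ (Set.range fun i => evalDiff (a' i) (b' i)) := by
    have hB : ∀ B, Submodule.span ℝ (Set.range fun i => evalDiff (a B i) (b B i)) ≤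
        Submodule.span ℝ (Set.range fun i => evalDiff (a' i) (b' i)) := fun B =>
      Submodule.span_mono (Set.range_subset_iff.2 fun i => ⟨Sum.inl (B, i), rfl⟩)
    rw [Submodule.span_le]
    rintro _ ⟨⟨B, j⟩ | e, rfl⟩
    · refine hB B ?_
      by_cases hj : j = 0
      · simpa [blockDifferences, hj, blockJump] using hjump B
      · simpa [blockDifferences, hj, blockSite] using hsite B j 0
    · exact Submodule.subset_span ⟨Sum.inr e, rfl⟩
  have : Module.Finite ℝ (Submodule.span ℝ (Set.range fun i => evalDiff (a' i) (b' i))) :=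
    Module.Finite.span_of_finite ℝ (Set.finite_range _)
  have hcard := linearIndependent_iff_card_eq_finrank_span.1 hind
  have hfin := Submodule.finrank_mono hle
  have hind' : LinearIndependent ℝ fun i => evalDiff (a' i) (b' i) :=
    linearIndependent_iff_card_le_finrank_span.2 (hcard.trans_le hfin)
  refine ⟨a', b', hind', (Submodule.eq_of_le_of_finrank_le hle ?_).symm⟩
  exact ((linearIndependent_iff_card_eq_finrank_span.1 hind').symm.trans hcard).le

theorem exists_independent_chords (c : Option β → Fin d) (hc : Function.Surjective c)
    (F : Submodule ℝ C(ℝ, ℝ)) [FiniteDimensional ℝ F]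
    (hF : finrank ℝ F = Fintype.card β * (d + 1) + (r + 1)) :
    ∃ a b : (β × Fin (d + 1)) ⊕ Fin r → ℝ,
      LinearIndependent ℝ (fun i => evalDiff (a i) (b i)) ∧
      d ≤ finrank ℝ ↥(F ⊓ ⨅ i, LinearMap.ker (evalDiff (a i) (b i))) := by
  obtain ⟨t, f, hfF, hf⟩ := exists_interpolation (ι := (β × Fin (d + 1)) ⊕ Fin (r + 1)) F
    (by simp [hF])
  have ht : Function.Injective t := fun p q hpq => by
    by_contra hne
    have h1 := hf p q
    rw [hpq, hf q q, if_neg hne, if_pos rfl] at h1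
    exact one_ne_zero h1
  obtain ⟨ε, hε, hdet⟩ := exists_pos_det_ne_zero (ι := (β × Fin (d + 1)) ⊕ Fin (r + 1))
  obtain ⟨h, hh, hsep, hnear⟩ := exists_scale t ht f (ε := ε / (d + 2)) (by positivity)
  have hdet' : ∀ u, (Matrix.of fun p q => blockSite t h u p (f q)).det ≠ 0 := fun u => by
    refine hdet _ fun p q => ?_
    rw [Matrix.of_apply, Matrix.one_apply, ← hf p q]
    refine (abs_blockSite_sub_le u hh.le (by positivity) (fun p => hnear p q) p).trans_lt ?_
    rw [← mul_div_assoc, div_lt_iff₀ (by positivity)]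
    linarith
  obtain ⟨u, hu, hzero⟩ := exists_config_common_zero c t h f hdet'
  obtain ⟨a, b, hind, hspan⟩ := exists_independent_chords_of_localized hh hsep hu
  refine ⟨a, b, hind, ?_⟩
  let φ : Fin d → C(ℝ, ℝ) := fun K => solve (Matrix.of fun p q => blockSite t h u p (f q)) f
    fun p => if siteClass c p = K then 1 else 0
  have hφ : ∀ p K, blockSite t h u p (φ K) = if siteClass c p = K then 1 else 0 := fun p K =>
    apply_solve _ f _ (hdet' u) p
  have hker : ∀ K i, evalDiff (a i) (b i) (φ K) = 0 := by
    intro K i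
    have h1 : Submodule.span ℝ
        (Set.range (blockDifferences (blockJump t h u) (blockSite t h u))) ≤
        LinearMap.ker (LinearMap.applyₗ (R := ℝ) (φ K)) := by
      rw [Submodule.span_le]
      rintro _ ⟨⟨B, j⟩ | e, rfl⟩
      · by_cases hj : j = 0
        · simpa [blockDifferences, hj] using hzero B K
        · simp [blockDifferences, hj, hφ, siteClass]
          exact sub_self _
      · simp [blockDifferences, hφ, siteClass]
        exact sub_self _
    exact h1 (hspan ▸ Submodule.subset_span (Set.mem_range_self i))
  have hmem : ∀ K, φ K ∈ F ⊓ ⨅ i, LinearMap.ker (evalDiff (a i) (b i)) := fun K =>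
    ⟨Submodule.sum_mem _ fun q _ => F.smul_mem _ (hfF q), by simpa using hker K⟩
  have hsite : ∀ K, ∃ p : (β × Fin (d + 1)) ⊕ Fin (r + 1), siteClass c p = K := by
    intro K
    obtain ⟨_ | B, hB⟩ := hc K
    · exact ⟨Sum.inr 0, hB⟩
    · exact ⟨Sum.inl (B, 0), hB⟩
  have hφind : LinearIndependent ℝ fun K =>
      (⟨φ K, hmem K⟩ : ↥(F ⊓ ⨅ i, LinearMap.ker (evalDiff (a i) (b i)))) := by
    rw [Fintype.linearIndependent_iff]
    intro g hg K
    obtain ⟨p, rfl⟩ := hsite K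
    have h1 := congrArg (fun x => blockSite t h u p (Subtype.val x)) hg
    simpa [hφ] using h1
  simpa using hφind.fintype_card_le_finrank

end Main

theorem exists_oriented_chords {ι : Type*} {a b : ι → ℝ}
    (hab : LinearIndependent ℝ fun i => evalDiff (a i) (b i)) :
    ∃ a' b' : ι → ℝ, (∀ i, a' i < b' i) ∧ Function.Injective (fun i => (a' i, b' i)) ∧
      LinearIndependent ℝ (fun i => evalDiff (a' i) (b' i)) ∧
      ∀ i, LinearMap.ker (evalDiff (a' i) (b' i)) = LinearMap.ker (evalDiff (a i) (b i)) := by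
  have hne : ∀ i, a i ≠ b i := fun i hi => hab.ne_zero i (by ext f; simp [evalDiff, hi])
  have hswap : ∀ i, evalDiff (b i) (a i) = -evalDiff (a i) (b i) := fun i => by
    ext f
    simp [evalDiff]
  have hunit : ∀ i, ∃ w : ℝˣ, evalDiff (min (a i) (b i)) (max (a i) (b i)) =
      w • evalDiff (a i) (b i) := by
    intro i
    rcases le_total (a i) (b i) with h | h
    · exact ⟨1, by rw [min_eq_left h, max_eq_right h, one_smul]⟩
    · exact ⟨-1, by rw [min_eq_right h, max_eq_left h, hswap]; ext f; simp⟩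
  choose w hw using hunit
  have hind : LinearIndependent ℝ fun i => evalDiff (min (a i) (b i)) (max (a i) (b i)) := by
    simp only [hw]
    exact hab.units_smul w
  refine ⟨fun i => min (a i) (b i), fun i => max (a i) (b i), fun i => min_lt_max.2 (hne i),
    fun i j hij => hind.injective ?_, hind, fun i => ?_⟩
  · simp only [Prod.mk.injEq] at hij
    simp only [hij.1, hij.2]
  · simp only [hw]
    exact LinearMap.ker_smul _ _ (w i).ne_zero

/-- Degeneration by at least 4: if n ≥ 30 and n ≤ N ≤ n + 1, every N-dimensional
subspace of C(ℝ, ℝ) admits a non-resonant n-chord diagram whose conditions cut out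
a subspace of codimension at most n - 4. -/
theorem stmt6 (n N : ℕ) (hn : 30 ≤ n) (hnN : n ≤ N) (hN : N ≤ n + 1)
    (F : Submodule ℝ C(ℝ, ℝ)) [FiniteDimensional ℝ F]
    (hF : Module.finrank ℝ F = N) :
    ∃ a b : Fin n → ℝ,
      (∀ i, a i < b i) ∧
      Function.Injective (fun i => (a i, b i)) ∧
      LinearIndependent ℝ (fun i => evalDiff (a i) (b i)) ∧
      (N : ℤ) - n + 4 ≤
        Module.finrank ℝ ↥(F ⊓ ⨅ i, LinearMap.ker (evalDiff (a i) (b i))) := by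
  obtain ⟨F', hFF', _, hF'⟩ : ∃ F' : Submodule ℝ C(ℝ, ℝ), F ≤ F' ∧ FiniteDimensional ℝ F' ∧
      Module.finrank ℝ F' = n + 1 := by
    rcases hN.eq_or_lt with h | h
    · exact ⟨F, le_rfl, inferInstance, hF.trans h⟩
    · obtain ⟨F', h1, h2, h3⟩ := exists_le_finrank_succ F
      exact ⟨F', h1, h2, by omega⟩
  obtain ⟨a, b, hind, hfin⟩ := exists_independent_chords (β := Fin 4) (d := 5) (r := n - 24)
    (finSuccEquiv 4).symm (finSuccEquiv 4).symm.surjective F'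
    (by rw [hF', Fintype.card_fin]; omega)
  let e : Fin n ≃ (Fin 4 × Fin 6) ⊕ Fin (n - 24) := Fintype.equivOfCardEq (by simp; omega)
  obtain ⟨a', b', hlt, hinj, hind', hker⟩ := exists_oriented_chords (hind.comp e e.injective)
  refine ⟨a', b', hlt, hinj, hind', ?_⟩
  have hK : (⨅ i, LinearMap.ker (evalDiff (a' i) (b' i))) =
      ⨅ i, LinearMap.ker (evalDiff (a i) (b i)) := by
    simp only [hker]
    exact e.iInf_comp (g := fun i => LinearMap.ker (evalDiff (a i) (b i)))
  rw [hK]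
  set K := ⨅ i, LinearMap.ker (evalDiff (a i) (b i))
  have h1 := Submodule.finrank_sup_add_finrank_inf_eq F (F' ⊓ K)
  rw [← inf_assoc, inf_eq_left.2 hFF'] at h1
  have h2 : Module.finrank ℝ ↥(F ⊔ F' ⊓ K) ≤ Module.finrank ℝ F' :=
    Submodule.finrank_mono (sup_le hFF' inf_le_left)
  omega
end

section
/- Let (a_i, b_i), i = 1,…,n, be an n-chord diagram containing no closed chain, i.e., there do not exist k ≥ 3, pairwise different indices i_1,…,i_k ∈ {1,…,n}, and points p_1,…,p_k ∈ ℝ such that for every j = 1,…,k the chord (a_{i_j}, b_{i_j}) equals the unordered pair {p_j, p_{j+1}} (indices taken modulo k). Then for every choice of real numbers c_1,…,c_n there exists a continuous function f : ℝ → ℝ with f(b_i) − f(a_i) = c_i for all i = 1,…,n. -/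
/-- The chord diagram `(a_i, b_i)` contains a closed chain: there are `k = m + 3 ≥ 3`
pairwise different indices `ι 0, …, ι (k-1)` and points `p 0, …, p (k-1)` such that
the chord `(a (ι j), b (ι j))` is the unordered pair `{p j, p (j+1)}` (cyclically). -/
def HasClosedChain {n : ℕ} (a b : Fin n → ℝ) : Prop :=
  ∃ m : ℕ, ∃ ι : Fin (m + 3) → Fin n, Function.Injective ι ∧
    ∃ p : Fin (m + 3) → ℝ,
      ∀ j : Fin (m + 3), ({a (ι j), b (ι j)} : Set ℝ) = {p j, p (j + 1)}

theorem Fin.eq_of_pair_succ_eq {α : Type*} {m : ℕ} {p : Fin (m + 3) → α}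
    (hp : Function.Injective p) {j l : Fin (m + 3)}
    (h : ({p j, p (j + 1)} : Set α) = {p l, p (l + 1)}) : j = l := by
  rcases Set.pair_eq_pair_iff.mp h with ⟨h₁, -⟩ | ⟨h₁, h₂⟩
  · exact hp h₁
  · have h₃ := hp h₁
    have h₄ := hp h₂
    rw [h₃, add_assoc, add_eq_left] at h₄
    simp [Fin.ext_iff, Fin.val_add, Nat.mod_eq_of_lt] at h₄

/-- A cycle of distinct points whose consecutive pairs are chords is a closed chain. -/
theorem hasClosedChain_of_injective {n m : ℕ} {a b : Fin n → ℝ} {p : Fin (m + 3) → ℝ}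
    (hp : Function.Injective p)
    (h : ∀ j, ∃ i, ({a i, b i} : Set ℝ) = {p j, p (j + 1)}) : HasClosedChain a b := by
  choose ι hι using h
  refine ⟨m, ι, fun j l hjl => Fin.eq_of_pair_succ_eq hp ?_, p, hι⟩
  rw [← hι, ← hι, hjl]

/-- The graph on the real line whose edges are the chords with index in `S`. -/
def chordGraph {n : ℕ} (a b : Fin n → ℝ) (S : Finset (Fin n)) : SimpleGraph ℝ :=
  SimpleGraph.fromRel fun x y => ∃ i ∈ S, a i = x ∧ b i = y

theorem chordGraph_adj_iff {n : ℕ} {a b : Fin n → ℝ} {S : Finset (Fin n)} {x y : ℝ} :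
    (chordGraph a b S).Adj x y ↔ x ≠ y ∧ ∃ i ∈ S, ({a i, b i} : Set ℝ) = {x, y} := by
  simp only [chordGraph, SimpleGraph.fromRel_adj, Set.pair_eq_pair_iff]
  grind

theorem not_reachable_chordGraph {n : ℕ} {a b : Fin n → ℝ} (hab : ∀ i, a i < b i)
    (hdist : Function.Injective fun i => (a i, b i)) (hnochain : ¬ HasClosedChain a b)
    {S : Finset (Fin n)} {i : Fin n} (hi : i ∉ S) :
    ¬ (chordGraph a b S).Reachable (a i) (b i) := by
  intro h
  obtain ⟨w, hw⟩ := h.exists_isPath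
  have hstep : ∀ j < w.length, ∃ l ∈ S, ({a l, b l} : Set ℝ) = {w.getVert j, w.getVert (j + 1)} :=
    fun j hj => (chordGraph_adj_iff.mp (w.adj_getVert_succ hj)).2
  obtain h0 | h1 | ⟨m, hm⟩ : w.length = 0 ∨ w.length = 1 ∨ ∃ m, w.length = m + 2 := by
    rcases w.length with _ | _ | m <;> simp
  · exact (hab i).ne (SimpleGraph.Walk.eq_of_length_eq_zero h0)
  · obtain ⟨-, l, hl, hpair⟩ := chordGraph_adj_iff.mp (SimpleGraph.Walk.adj_of_length_eq_one h1)
    rcases Set.pair_eq_pair_iff.mp hpair with ⟨ha, hb⟩ | ⟨ha, hb⟩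
    · exact hi (hdist (Prod.ext ha hb : (a l, b l) = (a i, b i)) ▸ hl)
    · linarith [hab i, hab l]
  · refine hnochain (hasClosedChain_of_injective (m := m) (p := fun j => w.getVert j) ?_ ?_)
    · intro j l hjl
      exact Fin.ext (hw.getVert_injOn (by simp; omega) (by simp; omega) hjl)
    · intro j
      rcases Fin.eq_castSucc_or_eq_last j with ⟨j, rfl⟩ | rfl
      · obtain ⟨l, -, hl⟩ := hstep j (by omega)
        exact ⟨l, by simpa using hl⟩
      · refine ⟨i, ?_⟩
        have hlast : w.getVert (m + 2) = b i := hm ▸ w.getVert_length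
        simp [hlast, Set.pair_comm]

theorem exists_potential {n : ℕ} {a b : Fin n → ℝ} (hab : ∀ i, a i < b i)
    (hdist : Function.Injective fun i => (a i, b i)) (hnochain : ¬ HasClosedChain a b)
    (c : Fin n → ℝ) (S : Finset (Fin n)) : ∃ g : ℝ → ℝ, ∀ i ∈ S, g (b i) - g (a i) = c i := by
  classical
  induction S using Finset.induction_on with
  | empty => exact ⟨0, by simp⟩
  | insert i S hi ih =>
    obtain ⟨g, hg⟩ := ih
    have hnot := not_reachable_chordGraph hab hdist hnochain hi
    refine ⟨fun x => if (chordGraph a b S).Reachable (a i) x then g x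
      else g x + (c i - (g (b i) - g (a i))), fun l hl => ?_⟩
    rcases Finset.mem_insert.mp hl with rfl | hl
    · simp only [hnot, SimpleGraph.Reachable.refl, if_true, if_false]
      ring
    · have hadj : (chordGraph a b S).Adj (a l) (b l) :=
        chordGraph_adj_iff.mpr ⟨(hab l).ne, l, hl, rfl⟩
      have hiff : (chordGraph a b S).Reachable (a i) (a l) ↔
          (chordGraph a b S).Reachable (a i) (b l) :=
        ⟨fun h => h.trans hadj.reachable, fun h => h.trans hadj.reachable.symm⟩
      have := hg l hl
      simp only [hiff]
      split_ifs <;> linarith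

/-- If an `n`-chord diagram contains no closed chain, then for any prescribed values
`c i` there is a continuous function `f : ℝ → ℝ` with `f (b i) - f (a i) = c i`
for all `i`. -/
theorem stmt8 (n : ℕ) (a b : Fin n → ℝ) (hab : ∀ i, a i < b i)
    (hdist : Function.Injective (fun i => (a i, b i)))
    (hnochain : ¬ HasClosedChain a b) :
    ∀ c : Fin n → ℝ, ∃ f : C(ℝ, ℝ), ∀ i, f (b i) - f (a i) = c i := by
  intro c
  obtain ⟨g, hg⟩ := exists_potential hab hdist hnochain c Finset.univ
  set s : Finset ℝ := Finset.univ.image a ∪ Finset.univ.image b with hs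
  have heval : ∀ x ∈ s, (Lagrange.interpolate s id g).eval x = g x := fun x hx =>
    Lagrange.eval_interpolate_at_node g Function.injective_id.injOn hx
  refine ⟨(Lagrange.interpolate s id g).toContinuousMap, fun i => ?_⟩
  have ha : a i ∈ s := by simp [hs]
  have hb : b i ∈ s := by simp [hs]
  rw [Polynomial.toContinuousMap_apply, Polynomial.toContinuousMap_apply, heval _ ha, heval _ hb]
  exact hg i (Finset.mem_univ i)
end

section
/- Two non-resonant n-chord diagrams D and D' (regarded as sets of n unordered pairs of distinct real numbers) define the same subalgebra {f ∈ C(ℝ,ℝ) : f(a) = f(b) for every chord {a,b} of the diagram} if and only if they can be connected by a finite chain of elementary flips through non-resonant n-chord diagrams, where an elementary flip transforms a diagram containing two chords {a,b} and {b,c} (with a, b, c pairwise distinct) into the diagram obtained by replacing the chord {b,c} with the chord {a,c} while keeping all other chords unchanged. -/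
/-- The chord (unordered pair) on the points `x ≠ y`, represented by the ordered
pair `(min x y, max x y)`. -/
noncomputable def chord (x y : ℝ) : ℝ × ℝ := (min x y, max x y)

/-- `D` is an `n`-chord diagram: a set of `n` pairwise distinct chords, each chord
being an unordered pair of distinct reals written as `(a, b)` with `a < b`. -/
def IsDiagram (n : ℕ) (D : Finset (ℝ × ℝ)) : Prop :=
  D.card = n ∧ ∀ p ∈ D, p.1 < p.2

/-- A chord diagram is non-resonant if the functionals `f ↦ f b - f a` over its
chords `(a, b)` are linearly independent. -/
def NonResonant (D : Finset (ℝ × ℝ)) : Prop :=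
  LinearIndependent ℝ (fun p : {x // x ∈ D} => evalDiff p.1.1 p.1.2)

/-- The subalgebra of `C(ℝ, ℝ)` corresponding to a chord diagram `D`: all continuous
functions taking equal values at the endpoints of every chord of `D`. -/
def subAlg (D : Finset (ℝ × ℝ)) : Set C(ℝ, ℝ) :=
  {f | ∀ p ∈ D, f p.1 = f p.2}

/-- An elementary flip: `D` contains the chords `{a, b}` and `{b, c}` (with `a`, `b`,
`c` pairwise distinct), and `D'` is obtained from `D` by replacing the chord `{b, c}`
with the chord `{a, c}`. -/
def Flip (D D' : Finset (ℝ × ℝ)) : Prop :=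
  ∃ a b c : ℝ, a ≠ b ∧ b ≠ c ∧ a ≠ c ∧
    chord a b ∈ D ∧ chord b c ∈ D ∧
    D' = insert (chord a c) (D.erase (chord b c))

/-- One step of a chain of elementary flips through non-resonant `n`-chord
diagrams. -/
def FlipStep (n : ℕ) (D D' : Finset (ℝ × ℝ)) : Prop :=
  IsDiagram n D ∧ IsDiagram n D' ∧ NonResonant D ∧ NonResonant D' ∧
    (Flip D D' ∨ Flip D' D)

open Relation

theorem chord_comm (x y : ℝ) : chord x y = chord y x := by
  simp [chord, min_comm, max_comm]

theorem chord_of_lt {x y : ℝ} (h : x < y) : chord x y = (x, y) := by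
  simp [chord, h.le]

theorem chord_fst_lt_snd {x y : ℝ} (h : x ≠ y) : (chord x y).1 < (chord x y).2 := by
  simpa [chord] using h.symm

theorem chord_eq_chord {x y a b : ℝ} (h : chord x y = chord a b) :
    (x = a ∧ y = b) ∨ (x = b ∧ y = a) := by
  simp only [chord, Prod.mk.injEq] at h
  grind

theorem apply_chord_eq_iff (f : ℝ → ℝ) (x y : ℝ) :
    f (chord x y).1 = f (chord x y).2 ↔ f x = f y := by
  rcases le_total x y with h | h <;> simp [chord, h, eq_comm]

/-- Two points are adjacent in `D` if they are the endpoints of a chord of `D`. -/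
def ChordAdj (D : Finset (ℝ × ℝ)) (x y : ℝ) : Prop := x ≠ y ∧ chord x y ∈ D

/-- Two points are connected in `D` if a path of chords of `D` joins them. -/
abbrev ChordConn (D : Finset (ℝ × ℝ)) : ℝ → ℝ → Prop := ReflTransGen (ChordAdj D)

theorem ChordConn.symm {D : Finset (ℝ × ℝ)} {x y : ℝ} (h : ChordConn D x y) :
    ChordConn D y x := by
  have : Std.Symm (ChordAdj D) := ⟨fun u v huv => ⟨huv.1.symm, chord_comm u v ▸ huv.2⟩⟩
  exact ReflTransGen.stdSymm.symm _ _ h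

theorem ChordConn.mono {D E : Finset (ℝ × ℝ)} (hDE : D ⊆ E) {x y : ℝ} (h : ChordConn D x y) :
    ChordConn E x y :=
  ReflTransGen.mono (fun _ _ huv => ⟨huv.1, hDE huv.2⟩) _ _ h

theorem ChordConn.erase {D : Finset (ℝ × ℝ)} {x y : ℝ} (a b : ℝ) (h : ChordConn D x y) :
    ChordConn (D.erase (chord a b)) x y ∨
      (ChordConn (D.erase (chord a b)) a x ∧ ChordConn (D.erase (chord a b)) b y) ∨
      (ChordConn (D.erase (chord a b)) b x ∧ ChordConn (D.erase (chord a b)) a y) := by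
  induction h with
  | refl => exact Or.inl .refl
  | @tail u v _ huv ih =>
    by_cases he : chord u v = chord a b
    · rcases chord_eq_chord he with ⟨rfl, rfl⟩ | ⟨rfl, rfl⟩
      · rcases ih with h | ⟨h, -⟩ | ⟨h, -⟩
        · exact Or.inr (Or.inl ⟨h.symm, .refl⟩)
        · exact Or.inr (Or.inl ⟨h, .refl⟩)
        · exact Or.inl h.symm
      · rcases ih with h | ⟨h, -⟩ | ⟨h, -⟩
        · exact Or.inr (Or.inr ⟨h.symm, .refl⟩)
        · exact Or.inl h.symm
        · exact Or.inr (Or.inr ⟨h, .refl⟩)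
    · have huv' : ChordAdj (D.erase (chord a b)) u v :=
        ⟨huv.1, Finset.mem_erase.2 ⟨he, huv.2⟩⟩
      rcases ih with h | ⟨h, h'⟩ | ⟨h, h'⟩
      · exact Or.inl (h.tail huv')
      · exact Or.inr (Or.inl ⟨h, h'.tail huv'⟩)
      · exact Or.inr (Or.inr ⟨h, h'.tail huv'⟩)

/-- A real-valued function on the line can be interpolated by a continuous one on a finite set. -/
theorem exists_continuousMap_eqOn (T : Finset ℝ) (g : ℝ → ℝ) :
    ∃ f : C(ℝ, ℝ), ∀ t ∈ T, f t = g t :=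
  ⟨(Lagrange.interpolate T id g).toContinuousMap, fun t ht => by
    simpa using Lagrange.eval_interpolate_at_node (v := id) g Function.injective_id.injOn ht⟩

theorem chordConn_of_forall_subAlg {n : ℕ} {D : Finset (ℝ × ℝ)} (hD : IsDiagram n D) {x y : ℝ}
    (h : ∀ f ∈ subAlg D, f x = f y) : ChordConn D x y := by
  classical
  obtain ⟨f, hf⟩ := exists_continuousMap_eqOn
    (insert x (insert y (D.image Prod.fst ∪ D.image Prod.snd)))
    (fun z => if ChordConn D x z then 1 else 0)
  have hfD : f ∈ subAlg D := by
    intro p hp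
    have hlt := hD.2 p hp
    have hadj : ChordAdj D p.1 p.2 := ⟨hlt.ne, by rwa [chord_of_lt hlt]⟩
    have h1 : p.1 ∈ D.image Prod.fst := Finset.mem_image_of_mem _ hp
    have h2 : p.2 ∈ D.image Prod.snd := Finset.mem_image_of_mem _ hp
    rw [hf p.1 (by simp only [Finset.mem_insert, Finset.mem_union]; tauto),
      hf p.2 (by simp only [Finset.mem_insert, Finset.mem_union]; tauto)]
    have hiff : ChordConn D x p.1 ↔ ChordConn D x p.2 :=
      ⟨fun h => h.tail hadj, fun h => h.trans (ChordConn.symm (.single hadj))⟩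
    simp only [hiff]
  have hxy := h f hfD
  rw [hf x (by simp), hf y (by simp), if_pos .refl] at hxy
  by_contra hn
  rw [if_neg hn] at hxy
  exact one_ne_zero hxy

/-- The span of the functionals attached to the chords of `D`. -/
noncomputable def chordSpan (D : Finset (ℝ × ℝ)) : Submodule ℝ (C(ℝ, ℝ) →ₗ[ℝ] ℝ) :=
  Submodule.span ℝ (Set.range fun p : {x // x ∈ D} => evalDiff p.1.1 p.1.2)

theorem evalDiff_mem_chordSpan {D : Finset (ℝ × ℝ)} {p : ℝ × ℝ} (hp : p ∈ D) :
    evalDiff p.1 p.2 ∈ chordSpan D :=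
  Submodule.subset_span ⟨⟨p, hp⟩, rfl⟩

theorem evalDiff_swap (x y : ℝ) : evalDiff y x = -evalDiff x y := by
  ext f; simp [evalDiff]

theorem evalDiff_add_evalDiff (x y z : ℝ) : evalDiff x y + evalDiff y z = evalDiff x z := by
  ext f; simp [evalDiff]

theorem evalDiff_chord_mem_iff (V : Submodule ℝ (C(ℝ, ℝ) →ₗ[ℝ] ℝ)) (x y : ℝ) :
    evalDiff (chord x y).1 (chord x y).2 ∈ V ↔ evalDiff x y ∈ V := by
  rcases le_total x y with h | h
  · simp [chord, h]
  · simp [chord, h, evalDiff_swap x y]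

theorem ChordConn.evalDiff_mem {D : Finset (ℝ × ℝ)} {x y : ℝ} (h : ChordConn D x y) :
    evalDiff x y ∈ chordSpan D := by
  induction h with
  | refl =>
    have : evalDiff x x = 0 := by ext f; simp [evalDiff]
    simp [this]
  | @tail u v _ huv ih =>
    rw [← evalDiff_add_evalDiff x u v]
    exact add_mem ih ((evalDiff_chord_mem_iff _ u v).1 (evalDiff_mem_chordSpan huv.2))

theorem NonResonant.not_chordConn_erase {D : Finset (ℝ × ℝ)} (hD : NonResonant D) {p : ℝ × ℝ}
    (hp : p ∈ D) : ¬ ChordConn (D.erase p) p.1 p.2 := by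
  intro h
  have hnot := hD.notMem_span_image (s := {q | q.1 ≠ p}) (x := ⟨p, hp⟩) (by simp)
  refine hnot (Submodule.span_mono ?_ h.evalDiff_mem)
  rintro _ ⟨⟨q, hq⟩, rfl⟩
  exact ⟨⟨q, Finset.mem_of_mem_erase hq⟩, Finset.ne_of_mem_erase hq, rfl⟩

theorem Flip.chordSpan_le {D D' : Finset (ℝ × ℝ)} (h : Flip D D') :
    chordSpan D ≤ chordSpan D' := by
  obtain ⟨a, b, c, hab, hbc, hac, h1, h2, rfl⟩ := h
  have hne : chord a b ≠ chord b c := fun h => by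
    rcases chord_eq_chord h with h | h <;> tauto
  have h1' := (evalDiff_chord_mem_iff _ a b).1 (evalDiff_mem_chordSpan
    (D := insert (chord a c) (D.erase (chord b c))) (p := chord a b) (by simp [h1, hne]))
  have h3 := (evalDiff_chord_mem_iff _ a c).1 (evalDiff_mem_chordSpan
    (D := insert (chord a c) (D.erase (chord b c))) (p := chord a c) (by simp))
  refine Submodule.span_le.2 ?_
  rintro _ ⟨⟨p, hp⟩, rfl⟩
  by_cases hpe : p = chord b c
  · subst hpe
    refine (evalDiff_chord_mem_iff _ b c).2 ?_
    rw [← evalDiff_add_evalDiff b a c, evalDiff_swap a b]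
    exact add_mem (neg_mem h1') h3
  · exact evalDiff_mem_chordSpan (by simp [hp, hpe])

/-- Flips turn non-resonant `n`-chord diagrams into non-resonant `n`-chord diagrams. -/
theorem Flip.isDiagram_and_nonResonant {n : ℕ} {D D' : Finset (ℝ × ℝ)} (h : Flip D D')
    (hD : IsDiagram n D) (hr : NonResonant D) : IsDiagram n D' ∧ NonResonant D' := by
  have hle := h.chordSpan_le
  have hD'le : D'.card ≤ n ∧ ∀ p ∈ D', p.1 < p.2 := by
    obtain ⟨a, b, c, hab, hbc, hac, h1, h2, rfl⟩ := h
    refine ⟨?_, ?_⟩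
    · have := Finset.card_insert_le (chord a c) (D.erase (chord b c))
      rwa [Finset.card_erase_add_one h2, hD.1] at this
    · intro p hp
      rcases Finset.mem_insert.1 hp with rfl | hp
      · exact chord_fst_lt_snd hac
      · exact hD.2 p (Finset.mem_of_mem_erase hp)
  have hfinD : Module.finrank ℝ (chordSpan D) = n := by
    rw [chordSpan, finrank_span_eq_card hr, Fintype.card_coe, hD.1]
  have : FiniteDimensional ℝ (chordSpan D') :=
    FiniteDimensional.span_of_finite ℝ (Set.finite_range _)
  have hge := Submodule.finrank_mono hle
  have hle' : Module.finrank ℝ (chordSpan D') ≤ D'.card := by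
    rw [← Fintype.card_coe D']
    exact finrank_range_le_card (R := ℝ) fun p : {x // x ∈ D'} => evalDiff p.1.1 p.1.2
  refine ⟨⟨by omega, hD'le.2⟩, ?_⟩
  refine linearIndependent_iff_card_le_finrank_span.2 ?_
  rw [Fintype.card_coe]
  change D'.card ≤ Module.finrank ℝ (chordSpan D')
  omega

theorem Flip.subAlg_eq {D D' : Finset (ℝ × ℝ)} (h : Flip D D') : subAlg D = subAlg D' := by
  obtain ⟨a, b, c, hab, hbc, hac, h1, h2, rfl⟩ := h
  have hne : chord a b ≠ chord b c := fun h => by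
    rcases chord_eq_chord h with h | h <;> tauto
  ext f
  constructor
  · intro hf p hp
    rcases Finset.mem_insert.1 hp with rfl | hp
    · exact (apply_chord_eq_iff f a c).2 (((apply_chord_eq_iff f a b).1 (hf _ h1)).trans
        ((apply_chord_eq_iff f b c).1 (hf _ h2)))
    · exact hf p (Finset.mem_of_mem_erase hp)
  · intro hf p hp
    by_cases hpe : p = chord b c
    · subst hpe
      have hab' := (apply_chord_eq_iff f a b).1 (hf _ (by simp [h1, hne]))
      have hac' := (apply_chord_eq_iff f a c).1 (hf _ (by simp))
      exact (apply_chord_eq_iff f b c).2 (hab'.symm.trans hac')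
    · exact hf p (by simp [hp, hpe])

theorem subAlg_eq_of_reflTransGen {n : ℕ} {D D' : Finset (ℝ × ℝ)}
    (h : ReflTransGen (FlipStep n) D D') : subAlg D = subAlg D' := by
  induction h with
  | refl => rfl
  | tail _ hs ih =>
    obtain ⟨-, -, -, -, hf | hf⟩ := hs
    · exact ih.trans hf.subAlg_eq
    · exact ih.trans hf.subAlg_eq.symm

/-- One endpoint of a chord can be moved by flips along a path of the other chords. -/
theorem ChordConn.move_endpoint {n : ℕ} {E : Finset (ℝ × ℝ)} {a a' b : ℝ}
    (hD : IsDiagram n (insert (chord a b) E)) (hr : NonResonant (insert (chord a b) E))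
    (hab : a ≠ b) (hE : chord a b ∉ E) (h : ChordConn E a a') :
    ReflTransGen (FlipStep n) (insert (chord a b) E) (insert (chord a' b) E) ∧
      IsDiagram n (insert (chord a' b) E) ∧ NonResonant (insert (chord a' b) E) ∧
      a' ≠ b ∧ chord a' b ∉ E := by
  have hcard : E.card + 1 = n := by rw [← hD.1, Finset.card_insert_of_notMem hE]
  induction h with
  | refl => exact ⟨.refl, hD, hr, hab, hE⟩
  | @tail u v _ huv ih =>
    obtain ⟨hchain, hDu, hru, hub, huE⟩ := ih
    have hvb : v ≠ b := by
      rintro rfl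
      exact huE huv.2
    have hflip : Flip (insert (chord u b) E) (insert (chord v b) E) :=
      ⟨v, u, b, huv.1.symm, hub, hvb,
        Finset.mem_insert_of_mem (chord_comm u v ▸ huv.2), Finset.mem_insert_self _ _,
        by rw [Finset.erase_insert huE]⟩
    obtain ⟨hDv, hrv⟩ := hflip.isDiagram_and_nonResonant hDu hru
    refine ⟨hchain.tail ⟨hDu, hDv, hru, hrv, Or.inl hflip⟩, hDv, hrv, hvb, fun hv => ?_⟩
    have := hDv.1
    rw [Finset.insert_eq_of_mem hv] at this
    omega

/-- Both endpoints of a chord can be moved by flips along paths of the other chords. -/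
theorem reflTransGen_of_chordConn_erase {n : ℕ} {D : Finset (ℝ × ℝ)} {a b x y : ℝ}
    (hD : IsDiagram n D) (hr : NonResonant D) (hab : a ≠ b) (h : chord a b ∈ D)
    (hx : ChordConn (D.erase (chord a b)) a x) (hy : ChordConn (D.erase (chord a b)) b y) :
    ReflTransGen (FlipStep n) D (insert (chord x y) (D.erase (chord a b))) ∧
      IsDiagram n (insert (chord x y) (D.erase (chord a b))) ∧
      NonResonant (insert (chord x y) (D.erase (chord a b))) := by
  have hins := Finset.insert_erase h
  obtain ⟨h1, hD1, hr1, hxb, hE1⟩ := hx.move_endpoint (b := b) (by rwa [hins]) (by rwa [hins]) hab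
    (Finset.notMem_erase _ _)
  rw [chord_comm x b] at h1 hD1 hr1 hE1
  obtain ⟨h2, hD2, hr2, -, -⟩ := hy.move_endpoint hD1 hr1 hxb.symm hE1
  rw [chord_comm y x] at h2 hD2 hr2
  rw [hins] at h1
  exact ⟨h1.trans h2, hD2, hr2⟩

/-- The exchange property: a chord of `D'` missing from `D` can be brought in by flips, at the
expense of a chord of `D` missing from `D'`. -/
theorem exists_exchange {n : ℕ} {D D' : Finset (ℝ × ℝ)} (hD : IsDiagram n D)
    (hD' : IsDiagram n D') (hr : NonResonant D) (hr' : NonResonant D')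
    (h : subAlg D = subAlg D') {p : ℝ × ℝ} (hp : p ∈ D') (hpD : p ∉ D) :
    ∃ e ∈ D, e ∉ D' ∧ ReflTransGen (FlipStep n) D (insert p (D.erase e)) ∧
      IsDiagram n (insert p (D.erase e)) ∧ NonResonant (insert p (D.erase e)) := by
  have hconn : ChordConn D p.1 p.2 :=
    chordConn_of_forall_subAlg hD fun f hf => (h ▸ hf : f ∈ subAlg D') p hp
  obtain ⟨F, hFD, hF⟩ := exists_minimal_le_of_wellFoundedLT
    (fun F => D ∩ D' ⊆ F ∧ ChordConn F p.1 p.2) D ⟨Finset.inter_subset_left, hconn⟩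
  obtain ⟨e, heF, heD'⟩ : ∃ e ∈ F, e ∉ D' := by
    by_contra! hc
    refine hr'.not_chordConn_erase hp (hF.prop.2.mono fun q hq => ?_)
    exact Finset.mem_erase.2 ⟨fun h => hpD (h ▸ hFD hq), hc q hq⟩
  have heD : e ∈ D := hFD heF
  obtain ⟨a, b⟩ := e
  have hab : a < b := hD.2 _ heD
  rw [← chord_of_lt hab] at heF heD' heD
  refine ⟨chord a b, heD, heD', ?_⟩
  have hnot : ¬ ChordConn (F.erase (chord a b)) p.1 p.2 := fun hc => by
    have hle := hF.le_of_le (y := F.erase (chord a b)) ⟨fun q hq => Finset.mem_erase.2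
      ⟨fun h => heD' (h ▸ (Finset.mem_inter.1 hq).2), hF.prop.1 hq⟩, hc⟩ (Finset.erase_subset _ _)
    exact Finset.notMem_erase _ _ (hle heF)
  have hsub : F.erase (chord a b) ⊆ D.erase (chord a b) := Finset.erase_subset_erase _ hFD
  have hpc : chord p.1 p.2 = p := chord_of_lt (hD'.2 p hp)
  rcases hF.prop.2.erase a b with hc | ⟨h1, h2⟩ | ⟨h1, h2⟩
  · exact absurd hc hnot
  · have := reflTransGen_of_chordConn_erase hD hr hab.ne heD (h1.mono hsub) (h2.mono hsub)
    rwa [hpc] at this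
  · have := reflTransGen_of_chordConn_erase hD hr hab.ne heD (h2.mono hsub) (h1.mono hsub)
    rwa [chord_comm, hpc] at this

theorem reflTransGen_of_subAlg_eq {n : ℕ} {D D' : Finset (ℝ × ℝ)} (hD : IsDiagram n D)
    (hD' : IsDiagram n D') (hr : NonResonant D) (hr' : NonResonant D')
    (h : subAlg D = subAlg D') : ReflTransGen (FlipStep n) D D' := by
  induction hk : (D' \ D).card using Nat.strong_induction_on generalizing D with
  | _ k ih =>
    by_cases hsub : D' ⊆ D
    · rw [Finset.eq_of_subset_of_card_le hsub (by rw [hD.1, hD'.1])]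
    · obtain ⟨p, hp, hpD⟩ := Finset.not_subset.1 hsub
      obtain ⟨e, -, heD', hchain, hD1, hr1⟩ := exists_exchange hD hD' hr hr' h hp hpD
      refine hchain.trans (ih _ ?_ hD1 hr1 ((subAlg_eq_of_reflTransGen hchain).symm.trans h) rfl)
      rw [← hk]
      refine Finset.card_lt_card (Finset.ssubset_iff_of_subset ?_ |>.2 ⟨p, ?_, ?_⟩)
      · intro q hq
        simp only [Finset.mem_sdiff, Finset.mem_insert, Finset.mem_erase] at hq ⊢
        grind
      · simp [hp, hpD]
      · simp

/-- Two non-resonant `n`-chord diagrams define the same subalgebra of `C(ℝ, ℝ)` iff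
they can be connected by a finite chain of elementary flips through non-resonant
`n`-chord diagrams. -/
theorem stmt10 (n : ℕ) (D D' : Finset (ℝ × ℝ))
    (hD : IsDiagram n D) (hD' : IsDiagram n D')
    (hr : NonResonant D) (hr' : NonResonant D') :
    subAlg D = subAlg D' ↔ Relation.ReflTransGen (FlipStep n) D D' :=
  ⟨reflTransGen_of_subAlg_eq hD hD' hr hr', subAlg_eq_of_reflTransGen⟩
end

section
/- Let n ≥ 1 and N ≥ 2n + 1 be natural numbers, and let (a_i, b_i) and (a'_i, b'_i), i = 1,…,n, be two non-resonant n-chord diagrams. If the subspaces {p ∈ P^N : p(a_i) = p(b_i) for all i} and {p ∈ P^N : p(a'_i) = p(b'_i) for all i} of P^N coincide, then the two diagrams are equivalent, i.e., the subalgebras {f ∈ C(ℝ,ℝ) : f(a_i) = f(b_i) for all i} and {f ∈ C(ℝ,ℝ) : f(a'_i) = f(b'_i) for all i} coincide. -/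
/-- `P^N`: the `N`-dimensional space of real polynomials of degree at most `N`
with zero constant term. -/
noncomputable def Pspace (N : ℕ) : Submodule ℝ (Polynomial ℝ) :=
  Polynomial.degreeLE ℝ (N : ℕ) ⊓ LinearMap.ker (Polynomial.lcoeff ℝ 0)

/-- Interpolating `f` at all the points involved shows that a relation `p c = p d`, which holds for
every `p ∈ P^N` respecting the chords `(a i, b i)`, also holds for every function respecting them. -/
theorem eq_of_forall_mem_Pspace {n N : ℕ} (hN : 2 * n + 1 ≤ N) (a b : Fin n → ℝ) (c d : ℝ)
    (h : ∀ p ∈ Pspace N, (∀ i, p.eval (a i) = p.eval (b i)) → p.eval c = p.eval d)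
    (f : ℝ → ℝ) (hf : ∀ i, f (a i) = f (b i)) : f c = f d := by
  classical
  let S : Finset ℝ := (Finset.univ.image a ∪ Finset.univ.image b) ∪ {c, d}
  have hS : S.card ≤ N + 1 := by
    have h₁ : (Finset.univ.image a).card ≤ n := by
      simpa using Finset.card_image_le (s := Finset.univ) (f := a)
    have h₂ : (Finset.univ.image b).card ≤ n := by
      simpa using Finset.card_image_le (s := Finset.univ) (f := b)
    have h₃ := Finset.card_union_le (Finset.univ.image a) (Finset.univ.image b)
    have h₄ := Finset.card_union_le (Finset.univ.image a ∪ Finset.univ.image b) {c, d}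
    have h₅ := Finset.card_le_two (a := c) (b := d)
    change (Finset.univ.image a ∪ Finset.univ.image b ∪ {c, d}).card ≤ N + 1
    lia
  set p := Lagrange.interpolate S id f
  have hinj : Set.InjOn (id : ℝ → ℝ) S := Function.injective_id.injOn
  have hp : ∀ x ∈ S, p.eval x = f x := fun x hx =>
    Lagrange.eval_interpolate_at_node f hinj hx
  have hdeg : p.degree ≤ N := by
    have hlt : p.degree < ((N + 1 : ℕ) : WithBot ℕ) :=
      (Lagrange.degree_interpolate_lt f hinj).trans_le (by exact_mod_cast hS)
    rw [Polynomial.degree_lt_iff_coeff_zero] at hlt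
    exact (Polynomial.degree_le_iff_coeff_zero _ _).2 fun m hm =>
      hlt m (Nat.succ_le_of_lt (by exact_mod_cast hm))
  have hmem : p - Polynomial.C (p.coeff 0) ∈ Pspace N := by
    refine ⟨Polynomial.mem_degreeLE.2 ?_, by simp⟩
    exact (Polynomial.degree_sub_le _ _).trans
      (max_le hdeg (Polynomial.degree_C_le.trans (by exact_mod_cast N.zero_le)))
  have hcd := h _ hmem fun i => by
    simp [hp (a i) (by simp [S]), hp (b i) (by simp [S]), hf i]
  simpa [hp c (by simp [S]), hp d (by simp [S])] using hcd

theorem mem_iInf_ker_leval_sub {n : ℕ} (a b : Fin n → ℝ) (p : Polynomial ℝ) :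
    p ∈ (⨅ i, LinearMap.ker (Polynomial.leval (b i) - Polynomial.leval (a i))) ↔
      ∀ i, p.eval (a i) = p.eval (b i) := by
  simp [Submodule.mem_iInf, sub_eq_zero, eq_comm (a := p.eval (a _))]

/-- If `N ≥ 2n + 1` and two non-resonant `n`-chord diagrams cut out the same subspace
of `P^N`, then they are equivalent: the corresponding subalgebras of `C(ℝ, ℝ)`
coincide. -/
theorem stmt11 (n N : ℕ) (hn : 1 ≤ n) (hN : 2 * n + 1 ≤ N)
    (a b a' b' : Fin n → ℝ)
    (hab : ∀ i, a i < b i) (hab' : ∀ i, a' i < b' i)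
    (hdist : Function.Injective (fun i => (a i, b i)))
    (hdist' : Function.Injective (fun i => (a' i, b' i)))
    (hnr : LinearIndependent ℝ (fun i => evalDiff (a i) (b i)))
    (hnr' : LinearIndependent ℝ (fun i => evalDiff (a' i) (b' i)))
    (heq :
      (Pspace N ⊓ ⨅ i, LinearMap.ker (Polynomial.leval (b i) - Polynomial.leval (a i))) =
      (Pspace N ⊓ ⨅ i, LinearMap.ker (Polynomial.leval (b' i) - Polynomial.leval (a' i)))) :
    {f : C(ℝ, ℝ) | ∀ i, f (a i) = f (b i)} = {f : C(ℝ, ℝ) | ∀ i, f (a' i) = f (b' i)} := by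
  have hiff : ∀ p ∈ Pspace N,
      (∀ i, p.eval (a i) = p.eval (b i)) ↔ ∀ i, p.eval (a' i) = p.eval (b' i) := by
    intro p hp
    have := SetLike.ext_iff.1 heq p
    rwa [Submodule.mem_inf, Submodule.mem_inf, mem_iInf_ker_leval_sub, mem_iInf_ker_leval_sub,
      and_iff_right hp, and_iff_right hp] at this
  ext f
  exact ⟨fun hf i => eq_of_forall_mem_Pspace hN a b _ _ (fun p hp h => (hiff p hp).1 h i) f hf,
    fun hf i => eq_of_forall_mem_Pspace hN a' b' _ _ (fun p hp h => (hiff p hp).2 h i) f hf⟩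
end
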